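/- Theorem 3.2(ii) (linear convergence for Łojasiewicz exponent in (0, 1/2]): Under the stated assumptions (a)–(e) and the Łojasiewicz assumption with exponent α ∈ (0, 1/2], there exist k₀ ≥ 0, ξ > 0 and μ ∈ [0, 1) such that for all k > k₀, dist((U^k, V^k, λ^k), 𝒲) ≤ ξ μ^{k − k₀}, where 𝒲 is the set of KKT points of the penalized problem and dist denotes the distance induced by the Frobenius/Euclidean norm on triples. -/

import Mathlib

open Matrix
open scoped BigOperators

noncomputable section

/-- Frobenius inner product of two real matrices. -/
def frobInner {α β : Type*} [Fintype α] [Fintype β] (X Y : Matrix α β ℝ) : ℝ :=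
  ∑ i, ∑ j, X i j * Y i j

/-- Frobenius norm of a real matrix. -/
def frobNorm {α β : Type*} [Fintype α] [Fintype β] (X : Matrix α β ℝ) : ℝ :=
  Real.sqrt (∑ i, ∑ j, (X i j) ^ 2)

/-- Euclidean norm of a real vector. -/
def vecNorm {α : Type*} [Fintype α] (v : α → ℝ) : ℝ :=
  Real.sqrt (∑ i, (v i) ^ 2)

/-- The linear map `𝒜(X) = (⟨A 1, X⟩, …, ⟨A m, X⟩)`. -/
def Aop {n m : ℕ} (A : Fin m → Matrix (Fin n) (Fin n) ℝ)
    (X : Matrix (Fin n) (Fin n) ℝ) : Fin m → ℝ :=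
  fun i => frobInner (A i) X

/-- `s_A = Σ_i ‖A_i‖_F²`. -/
def sA {n m : ℕ} (A : Fin m → Matrix (Fin n) (Fin n) ℝ) : ℝ :=
  ∑ i, (frobNorm (A i)) ^ 2

/-- `(U, V, λ)` is an ε-KKT point of the penalized problem
`min f(UVᵀ) + (γ/2)‖U-V‖² s.t. 𝒜(UVᵀ) = b`, where `grad` denotes the gradient of `f`. -/
def IsPenEpsKKT {n m r : ℕ} (grad : Matrix (Fin n) (Fin n) ℝ → Matrix (Fin n) (Fin n) ℝ)
    (A : Fin m → Matrix (Fin n) (Fin n) ℝ) (b : Fin m → ℝ) (γ ε : ℝ)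
    (U V : Matrix (Fin n) (Fin r) ℝ) (lam : Fin m → ℝ) : Prop :=
  frobNorm (grad (U * Vᵀ) * V + γ • (U - V) + ∑ i, lam i • (A i * V)) ≤ ε ∧
  frobNorm (grad (V * Uᵀ) * U + γ • (V - U) + ∑ i, lam i • (A i * U)) ≤ ε ∧
  vecNorm (fun i => Aop A (U * Vᵀ) i - b i) ≤ ε

/-- `(U, λ)` is an ε-KKT point of the Burer–Monteiro problem
`min f(UUᵀ) s.t. 𝒜(UUᵀ) = b`, where `grad` denotes the gradient of `f`. -/
def IsBMEpsKKT {n m r : ℕ} (grad : Matrix (Fin n) (Fin n) ℝ → Matrix (Fin n) (Fin n) ℝ)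
    (A : Fin m → Matrix (Fin n) (Fin n) ℝ) (b : Fin m → ℝ) (ε : ℝ)
    (U : Matrix (Fin n) (Fin r) ℝ) (lam : Fin m → ℝ) : Prop :=
  frobNorm ((2 : ℝ) • (grad (U * Uᵀ) * U) + ∑ i, lam i • (A i * U)) ≤ ε ∧
  vecNorm (fun i => Aop A (U * Uᵀ) i - b i) ≤ ε

/-- The augmented Lagrangian `L_ρ(U,V,λ)` of the penalized problem. -/
def augL {n m r : ℕ} (f : Matrix (Fin n) (Fin n) ℝ → ℝ)
    (A : Fin m → Matrix (Fin n) (Fin n) ℝ) (b : Fin m → ℝ) (ρ γ : ℝ)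
    (U V : Matrix (Fin n) (Fin r) ℝ) (lam : Fin m → ℝ) : ℝ :=
  f (U * Vᵀ) + γ / 2 * (frobNorm (U - V)) ^ 2
    + ∑ i, lam i * (Aop A (U * Vᵀ) i - b i)
    + ρ / 2 * (vecNorm (fun i => Aop A (U * Vᵀ) i - b i)) ^ 2

/-- The level set `S_β` of the penalty function. -/
def Sset {n m r : ℕ} (f : Matrix (Fin n) (Fin n) ℝ → ℝ)
    (A : Fin m → Matrix (Fin n) (Fin n) ℝ) (b : Fin m → ℝ) (ρ₀ β : ℝ) :
    Set (Matrix (Fin n) (Fin r) ℝ × Matrix (Fin n) (Fin r) ℝ) :=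
  {p | f (p.1 * p.2ᵀ) + ρ₀ / 2 * (frobNorm (p.1 - p.2)) ^ 2
      + ρ₀ / 2 * (vecNorm (fun i => Aop A (p.1 * p.2ᵀ) i - b i)) ^ 2 ≤ β}

/-- `𝒞(U)`: the `nr × m` matrix whose `i`-th column is the vectorization of `A_i U`. -/
def Cmat {n m r : ℕ} (A : Fin m → Matrix (Fin n) (Fin n) ℝ)
    (U : Matrix (Fin n) (Fin r) ℝ) : Matrix (Fin n × Fin r) (Fin m) ℝ :=
  Matrix.of fun p i => (A i * U) p.1 p.2

/-- Smallest singular value of a real matrix, as the infimum of `‖Mx‖` over unit vectors. -/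
def sigmaMin {α β : Type*} [Fintype α] [Fintype β] (M : Matrix α β ℝ) : ℝ :=
  sInf {s | ∃ x : β → ℝ, vecNorm x = 1 ∧ s = vecNorm (M.mulVec x)}

/-- Norm of the full gradient of the augmented Lagrangian at `(U, V, λ)`
(for symmetric `f`, with `grad` the gradient of `f`). -/
def gradAugLNorm {n m r : ℕ} (grad : Matrix (Fin n) (Fin n) ℝ → Matrix (Fin n) (Fin n) ℝ)
    (A : Fin m → Matrix (Fin n) (Fin n) ℝ) (b : Fin m → ℝ) (ρ γ : ℝ)
    (U V : Matrix (Fin n) (Fin r) ℝ) (lam : Fin m → ℝ) : ℝ :=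
  Real.sqrt
    ((frobNorm (grad (U * Vᵀ) * V + γ • (U - V)
        + ∑ i, (lam i + ρ * (Aop A (U * Vᵀ) i - b i)) • (A i * V))) ^ 2
      + (frobNorm (grad (V * Uᵀ) * U + γ • (V - U)
        + ∑ i, (lam i + ρ * (Aop A (U * Vᵀ) i - b i)) • (A i * U))) ^ 2
      + (vecNorm (fun i => Aop A (U * Vᵀ) i - b i)) ^ 2)

/-- Distance between two primal-dual triples, induced by the Frobenius/Euclidean norms. -/
def tripDist {n m r : ℕ}
    (p q : Matrix (Fin n) (Fin r) ℝ × Matrix (Fin n) (Fin r) ℝ × (Fin m → ℝ)) : ℝ :=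
  Real.sqrt ((frobNorm (p.1 - q.1)) ^ 2 + (frobNorm (p.2.1 - q.2.1)) ^ 2
    + (vecNorm (fun i => p.2.2 i - q.2.2 i)) ^ 2)

/-- The set `𝒲` of KKT points of the penalized problem. -/
def KKTset {n m : ℕ} (r : ℕ) (grad : Matrix (Fin n) (Fin n) ℝ → Matrix (Fin n) (Fin n) ℝ)
    (A : Fin m → Matrix (Fin n) (Fin n) ℝ) (b : Fin m → ℝ) (γ : ℝ) :
    Set (Matrix (Fin n) (Fin r) ℝ × Matrix (Fin n) (Fin r) ℝ × (Fin m → ℝ)) :=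
  {p | IsPenEpsKKT grad A b γ 0 p.1 p.2.1 p.2.2}

section Convergence

open scoped RealInnerProductSpace
open Filter Topology

/-- The part of the matrix problem that the convergence argument uses: `h U V` stands for
`f (U Vᵀ)`, `G U V` for its gradient in `V`, `B U V` for `𝒜 (U Vᵀ)`, and `C U` for the adjoint
of `B U`. -/
structure FactoredModel (E M : Type*) [NormedAddCommGroup E] [InnerProductSpace ℝ E]
    [NormedAddCommGroup M] [InnerProductSpace ℝ M] where
  h : E → E → ℝ
  G : E → E → E
  B : E →L[ℝ] E →L[ℝ] M
  C : E →L[ℝ] M →L[ℝ] E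
  b : M
  γ : ℝ
  ρ : ℝ
  ρ₀ : ℝ
  δ : ℝ
  η : ℝ
  Lf : ℝ
  L : ℝ
  a : ℝ
  β₀ : ℝ
  β : ℝ
  h_symm : ∀ U V, h U V = h V U
  h_scale : ∀ s : ℝ, s ≠ 0 → ∀ U V, h (s⁻¹ • U) (s • V) = h U V
  h_convex : ∀ U V V', h U V + ⟪G U V, V' - V⟫ ≤ h U V'
  h_cont : Continuous fun p : E × E => h p.1 p.2
  G_cont : Continuous fun p : E × E => G p.1 p.2
  B_symm : ∀ U V, B U V = B V U
  C_adjoint : ∀ U x V, ⟪C U x, V⟫ = ⟪x, B U V⟫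
  C_bound : ∀ U x, ‖C U x‖ ≤ a * ‖U‖ * ‖x‖
  G_bound : ∀ U V, ‖U‖ * ‖V‖ ≤ δ ^ 2 → ‖G U V‖ ≤ Lf * ‖U‖
  G_lip : ∀ U V U' V', ‖U‖ * ‖V‖ ≤ δ ^ 2 → ‖U'‖ * ‖V'‖ ≤ δ ^ 2 → ‖U‖ ≤ δ → ‖U'‖ ≤ δ →
    ‖G U' V' - G U V‖ ≤ (L * δ ^ 2 + Lf) * ‖U' - U‖ + L * δ ^ 2 * ‖V' - V‖
  G_lip_bdd : ∀ R, ∃ K, 0 ≤ K ∧ ∀ U U' V, ‖U‖ ≤ R → ‖U'‖ ≤ R → ‖V‖ ≤ R →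
    ‖G U' V - G U V‖ ≤ K * ‖U' - U‖
  γ_pos : 0 < γ
  ρ_pos : 0 < ρ
  ρ₀_pos : 0 < ρ₀
  δ_pos : 0 < δ
  η_pos : 0 < η
  Lf_pos : 0 < Lf
  L_pos : 0 < L
  a_nonneg : 0 ≤ a
  ρ₀_lt : ρ₀ < γ
  two_ρ₀_lt : 2 * ρ₀ < ρ
  level : ∀ U V, h U V + ρ₀ / 2 * ‖U - V‖ ^ 2 + ρ₀ / 2 * ‖B U V - b‖ ^ 2 ≤ β →
    ‖U‖ ≤ δ ∧ ‖V‖ ≤ δ ∧ ∀ x, η * ‖x‖ ≤ ‖C U x‖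
  ρ_big : 4 * (L * δ ^ 2 + Lf + γ + (Lf * δ + 2 * γ * δ) / η * a) ^ 2 < ρ * γ * η ^ 2
  ρ_gap : ((Lf * δ + 2 * γ * δ) / η) ^ 2 < ρ * (β - β₀)

namespace FactoredModel

variable {E M : Type*} [NormedAddCommGroup E] [InnerProductSpace ℝ E]
  [NormedAddCommGroup M] [InnerProductSpace ℝ M] (P : FactoredModel E M)

/-- The bound on the multipliers. -/
def mult : ℝ := (P.Lf * P.δ + 2 * P.γ * P.δ) / P.η

/-- Lipschitz constant of the multipliers in the first factor, up to `η`. -/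
def lipU : ℝ := P.L * P.δ ^ 2 + P.Lf + P.γ + P.mult * P.a

/-- Lipschitz constant of the multipliers in the second factor, up to `η`. -/
def lipV : ℝ := P.L * P.δ ^ 2 + P.γ

/-- The constraint residual. -/
def res (U V : E) : M := P.B U V - P.b

/-- The penalized objective. -/
def obj (U V : E) : ℝ := P.h U V + P.γ / 2 * ‖U - V‖ ^ 2

/-- The gradient of the penalized objective in the second factor. -/
def objGrad (U V : E) : E := P.G U V + P.γ • (V - U)

/-- The augmented Lagrangian. -/
def lag (U V : E) (lam : M) : ℝ :=
  P.obj U V + ⟪lam, P.res U V⟫ + P.ρ / 2 * ‖P.res U V‖ ^ 2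

/-- The gradient of the augmented Lagrangian in the second factor. -/
def lagGrad (U V : E) (lam : M) : E := P.objGrad U V + P.C U (lam + P.ρ • P.res U V)

/-- The penalty function whose level sets are bounded. -/
def pen (U V : E) : ℝ :=
  P.h U V + P.ρ₀ / 2 * ‖U - V‖ ^ 2 + P.ρ₀ / 2 * ‖P.res U V‖ ^ 2

lemma res_symm (U V : E) : P.res U V = P.res V U := by
  simp only [res, P.B_symm U V]

lemma obj_symm (U V : E) : P.obj U V = P.obj V U := by
  simp only [obj, P.h_symm U V, norm_sub_rev U V]

lemma lag_symm (U V : E) (lam : M) : P.lag U V lam = P.lag V U lam := by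
  simp only [lag, P.obj_symm U V, P.res_symm U V]

lemma pen_symm (U V : E) : P.pen U V = P.pen V U := by
  simp only [pen, P.h_symm U V, P.res_symm U V, norm_sub_rev U V]

lemma res_sub (U V V' : E) : P.res U V' - P.res U V = P.B U (V' - V) := by
  simp [res, map_sub]

lemma continuous_res : Continuous fun p : E × E => P.res p.1 p.2 := by
  unfold res; fun_prop

lemma continuous_obj : Continuous fun p : E × E => P.obj p.1 p.2 := by
  have := P.h_cont
  unfold obj; fun_prop

lemma continuous_pen : Continuous fun p : E × E => P.pen p.1 p.2 := by
  have := P.h_cont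
  have := P.continuous_res
  unfold pen; fun_prop

lemma continuous_lag : Continuous fun p : E × E × M => P.lag p.1 p.2.1 p.2.2 := by
  have h1 : Continuous fun p : E × E × M => P.obj p.1 p.2.1 :=
    P.continuous_obj.comp (continuous_fst.prodMk (continuous_fst.comp continuous_snd))
  have h2 : Continuous fun p : E × E × M => P.res p.1 p.2.1 :=
    P.continuous_res.comp (continuous_fst.prodMk (continuous_fst.comp continuous_snd))
  unfold lag; fun_prop

lemma continuous_lagGrad : Continuous fun p : E × E × M => P.lagGrad p.1 p.2.1 p.2.2 := by
  have h1 : Continuous fun p : E × E × M => P.G p.1 p.2.1 :=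
    P.G_cont.comp (continuous_fst.prodMk (continuous_fst.comp continuous_snd))
  have h2 : Continuous fun p : E × E × M => P.res p.1 p.2.1 :=
    P.continuous_res.comp (continuous_fst.prodMk (continuous_fst.comp continuous_snd))
  unfold lagGrad objGrad; fun_prop

/-- Strong convexity of the penalized objective in the second factor. -/
lemma obj_strong (U V V' : E) :
    P.obj U V + ⟪P.objGrad U V, V' - V⟫ + P.γ / 2 * ‖V' - V‖ ^ 2 ≤ P.obj U V' := by
  have h1 := P.h_convex U V V'
  have h2 : ‖U - V'‖ ^ 2 = ‖U - V‖ ^ 2 + 2 * ⟪V - U, V' - V⟫ + ‖V' - V‖ ^ 2 := by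
    rw [norm_sub_rev U V', norm_sub_rev U V, ← norm_add_sq_real]
    congr 2; abel
  simp only [obj, objGrad, inner_add_left, real_inner_smul_left]
  rw [h2]; linarith

/-- Strong convexity of the augmented Lagrangian in the second factor. -/
lemma lag_strong (U V V' : E) (lam : M) :
    P.lag U V lam + ⟪P.lagGrad U V lam, V' - V⟫ + P.γ / 2 * ‖V' - V‖ ^ 2 ≤ P.lag U V' lam := by
  have h1 := P.obj_strong U V V'
  have h2 : P.res U V' = P.res U V + P.B U (V' - V) := by rw [← P.res_sub]; abel
  have h3 := P.ρ_pos
  simp only [lag, lagGrad, inner_add_left, P.C_adjoint, h2, inner_add_right,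
    real_inner_smul_left, norm_add_sq_real]
  nlinarith [sq_nonneg ‖P.B U (V' - V)‖]

/-- Convexity of the objective at a stationary point with multiplier `ν`. -/
lemma obj_le_of_stationary {U V : E} {ν : M} (hν : P.C U ν = -P.objGrad U V) (V' : E) :
    P.obj U V + P.γ / 2 * ‖V' - V‖ ^ 2 ≤ P.obj U V' + ⟪ν, P.res U V' - P.res U V⟫ := by
  have h1 := P.obj_strong U V V'
  rw [P.res_sub, ← P.C_adjoint, hν, inner_neg_left]
  linarith

lemma pen_le_lag (U V : E) (lam : M) : P.pen U V ≤ P.lag U V lam + ‖lam‖ ^ 2 / P.ρ := by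
  have h1 := P.two_ρ₀_lt
  have h2 := P.ρ_pos
  have h3 := P.ρ₀_lt
  have h4 : 0 ≤ ‖lam + (P.ρ / 2) • P.res U V‖ ^ 2 / P.ρ := by positivity
  have h5 : ‖lam + (P.ρ / 2) • P.res U V‖ ^ 2 / P.ρ
      = ‖lam‖ ^ 2 / P.ρ + ⟪lam, P.res U V⟫ + P.ρ / 4 * ‖P.res U V‖ ^ 2 := by
    rw [norm_add_sq_real, real_inner_smul_right, norm_smul, Real.norm_of_nonneg (by positivity)]
    field_simp
    ring
  simp only [pen, lag, obj]
  nlinarith [sq_nonneg ‖U - V‖, sq_nonneg ‖P.res U V‖]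

/-- A gradient inequality with continuous gradient forces the gradient to vanish at a minimizer. -/
lemma lagGrad_eq_zero {U V : E} {lam : M} (hmin : ∀ V', P.lag U V lam ≤ P.lag U V' lam) :
    P.lagGrad U V lam = 0 := by
  have hc : Continuous fun t : ℝ => ⟪P.lagGrad U (V - t • P.lagGrad U V lam) lam,
      P.lagGrad U V lam⟫ := by
    have h1 : Continuous fun t : ℝ => P.lagGrad U (V - t • P.lagGrad U V lam) lam :=
      P.continuous_lagGrad.comp (by fun_prop :
        Continuous fun t : ℝ => (U, V - t • P.lagGrad U V lam, lam))
    fun_prop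
  have hle : ∀ t ∈ Set.Ioi (0 : ℝ), ⟪P.lagGrad U (V - t • P.lagGrad U V lam) lam,
      P.lagGrad U V lam⟫ ≤ 0 := by
    intro t ht
    have h1 := P.lag_strong U (V - t • P.lagGrad U V lam) V lam
    have h2 := hmin (V - t • P.lagGrad U V lam)
    rw [sub_sub_cancel, real_inner_smul_right] at h1
    have h3 := P.γ_pos
    have h4 : 0 ≤ P.γ / 2 * ‖t • P.lagGrad U V lam‖ ^ 2 := by positivity
    have ht' : 0 < t := ht
    by_contra hcon
    push Not at hcon
    nlinarith [mul_pos ht' hcon]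
  have h0 : ⟪P.lagGrad U V lam, P.lagGrad U V lam⟫ ≤ 0 := by
    have ht := (hc.tendsto 0).mono_left (nhdsWithin_le_nhds (s := Set.Ioi (0 : ℝ)))
    simp only [zero_smul, sub_zero] at ht
    exact le_of_tendsto ht (eventually_nhdsWithin_of_forall hle)
  rw [real_inner_self_eq_norm_sq] at h0
  have : ‖P.lagGrad U V lam‖ = 0 := by nlinarith [norm_nonneg (P.lagGrad U V lam)]
  simpa using this

lemma mul_norm_sub_le {U V : E} {lam : M} (hV : P.lagGrad U V lam = 0) (V' : E) :
    P.γ * ‖V' - V‖ ≤ ‖P.lagGrad U V' lam‖ := by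
  have h1 := P.lag_strong U V V' lam
  have h2 := P.lag_strong U V' V lam
  rw [hV, inner_zero_left] at h1
  rw [← neg_sub V' V, inner_neg_right, norm_neg] at h2
  have h3 := real_inner_le_norm (P.lagGrad U V' lam) (V' - V)
  rcases (norm_nonneg (V' - V)).eq_or_lt with h | h
  · rw [← h]; simp
  · nlinarith

lemma exists_argmin [FiniteDimensional ℝ E] (U : E) (lam : M) :
    ∃ V, ∀ V', P.lag U V lam ≤ P.lag U V' lam := by
  have : ProperSpace E := FiniteDimensional.proper ℝ E
  have hc : Continuous fun V => P.lag U V lam :=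
    P.continuous_lag.comp (by fun_prop : Continuous fun V : E => (U, V, lam))
  refine hc.exists_forall_le ?_
  have hγ := P.γ_pos
  have h1 : ∀ V, P.lag U 0 lam + ‖V‖ * (P.γ / 2 * ‖V‖ - ‖P.lagGrad U 0 lam‖) ≤ P.lag U V lam := by
    intro V
    have h2 := P.lag_strong U 0 V lam
    rw [sub_zero] at h2
    have h3 := neg_le_of_abs_le (abs_real_inner_le_norm (P.lagGrad U 0 lam) V)
    nlinarith
  refine tendsto_atTop_mono h1 (tendsto_atTop_add_const_left _ _ ?_)
  have h4 := tendsto_norm_cocompact_atTop (E := E)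
  refine h4.atTop_mul_atTop₀ ?_
  exact tendsto_atTop_add_const_right _ _ (h4.const_mul_atTop (by positivity))

/-- The minimizer of the augmented Lagrangian in the second factor. -/
def argV [FiniteDimensional ℝ E] (U : E) (lam : M) : E := (P.exists_argmin U lam).choose

lemma lag_argV_le [FiniteDimensional ℝ E] (U V : E) (lam : M) :
    P.lag U (P.argV U lam) lam ≤ P.lag U V lam := (P.exists_argmin U lam).choose_spec V

lemma lagGrad_argV [FiniteDimensional ℝ E] (U : E) (lam : M) :
    P.lagGrad U (P.argV U lam) lam = 0 := P.lagGrad_eq_zero fun V => P.lag_argV_le U V lam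

lemma eq_argV [FiniteDimensional ℝ E] {U V : E} {lam : M} (hV : P.lagGrad U V lam = 0) :
    V = P.argV U lam := by
  have h := P.mul_norm_sub_le (P.lagGrad_argV U lam) V
  rw [hV, norm_zero] at h
  have h1 : ‖V - P.argV U lam‖ ≤ 0 := nonpos_of_mul_nonpos_right h P.γ_pos
  exact sub_eq_zero.1 (norm_le_zero_iff.1 h1)

lemma continuous_argV [FiniteDimensional ℝ E] :
    Continuous fun p : E × M => P.argV p.1 p.2 := by
  rw [continuous_iff_continuousAt]
  intro p
  rw [ContinuousAt, tendsto_iff_norm_sub_tendsto_zero]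
  have hc : Continuous fun q : E × M => ‖P.lagGrad q.1 (P.argV p.1 p.2) q.2‖ / P.γ :=
    ((P.continuous_lagGrad.comp (by fun_prop :
      Continuous fun q : E × M => (q.1, P.argV p.1 p.2, q.2))).norm).div_const _
  have ht := hc.tendsto p
  simp only [lagGrad_argV, norm_zero, zero_div] at ht
  refine squeeze_zero (fun _ => norm_nonneg _) (fun q => ?_) ht
  rw [le_div_iff₀ P.γ_pos, mul_comm, norm_sub_rev]
  exact P.mul_norm_sub_le (P.lagGrad_argV q.1 q.2) _

lemma C_mult_of_lagGrad {U V : E} {lam : M} (hV : P.lagGrad U V lam = 0) :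
    P.C U (lam + P.ρ • P.res U V) = -P.objGrad U V := by
  rw [lagGrad] at hV
  exact (neg_eq_of_add_eq_zero_right hV).symm

lemma mult_pos : 0 < P.mult := by
  have h1 := P.Lf_pos
  have h2 := P.δ_pos
  have h3 := P.γ_pos
  have h4 := P.η_pos
  unfold mult; positivity

lemma lipV_pos : 0 < P.lipV := by
  have h1 := P.L_pos
  have h2 := P.γ_pos
  unfold lipV; positivity

lemma lipV_le_lipU : P.lipV ≤ P.lipU := by
  have h1 := mul_nonneg P.mult_pos.le P.a_nonneg
  have h2 := P.Lf_pos
  simp only [lipV, lipU]; linarith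

lemma lipU_sq_lt : 4 * P.lipU ^ 2 < P.ρ * P.γ * P.η ^ 2 := P.ρ_big

lemma mult_sq_lt : P.mult ^ 2 < P.ρ * (P.β - P.β₀) := P.ρ_gap

/-- If the penalty level set is nonempty, the lower bound `η` is at most `a * δ`, and the
penalty parameter dominates the Lipschitz constants. -/
lemma twelve_mul_le [Nontrivial M] {U V : E} (h : P.pen U V ≤ P.β) :
    12 * (P.lipV + 2 * P.ρ₀) ≤ P.ρ * P.η ^ 2 := by
  obtain ⟨hU, -, hx⟩ := P.level U V h
  obtain ⟨x, hx0⟩ := exists_ne (0 : M)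
  have hx1 : 0 < ‖x‖ := norm_pos_iff.2 hx0
  have h1 := (hx x).trans (P.C_bound U x)
  have h2 : P.η ≤ P.a * ‖U‖ := le_of_mul_le_mul_right h1 hx1
  have h3 : P.η ≤ P.a * P.δ := h2.trans (mul_le_mul_of_nonneg_left hU P.a_nonneg)
  have h4 : P.Lf + 2 * P.γ ≤ P.mult * P.a := by
    have : P.mult * P.a = (P.Lf + 2 * P.γ) * (P.a * P.δ / P.η) := by unfold mult; ring
    rw [this]
    have h5 : 1 ≤ P.a * P.δ / P.η := by rwa [one_le_div P.η_pos]
    have := P.Lf_pos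
    have := P.γ_pos
    nlinarith
  have hV := P.lipV_pos
  have h6 : P.lipV + 2 * P.γ ≤ P.lipU := by
    have := P.Lf_pos
    simp only [lipV, lipU]; linarith
  have h7 : P.γ ≤ P.lipV := by
    have := P.L_pos
    have : 0 ≤ P.L * P.δ ^ 2 := by positivity
    simp only [lipV]; linarith
  have h8 := P.lipU_sq_lt
  have h9 := P.γ_pos
  have h10 := P.ρ₀_lt
  have h11 : P.γ * (12 * (P.lipV + 2 * P.γ)) ≤ P.γ * (P.ρ * P.η ^ 2) := by nlinarith
  have := le_of_mul_le_mul_left h11 h9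
  linarith

/-- A pair together with a correction `y` that stays in the region where the gradient bounds
hold when the second factor is moved by `‖y‖ / η`. -/
def Good (U V : E) (y : M) : Prop :=
  ‖U‖ ≤ P.δ ∧ (∀ x, P.η * ‖x‖ ≤ ‖P.C U x‖) ∧ ‖U‖ + ‖V‖ + ‖y‖ / P.η ≤ 2 * P.δ

lemma good_of_pen {U V : E} (h : P.pen U V ≤ P.β) : P.Good U V 0 := by
  obtain ⟨hU, hV, hx⟩ := P.level U V h
  exact ⟨hU, hx, by simp; linarith⟩

lemma Good.add_le {U V : E} {y : M} (h : P.Good U V y) : ‖U‖ + ‖V‖ ≤ 2 * P.δ := by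
  have := div_nonneg (norm_nonneg y) P.η_pos.le
  linarith [h.2.2]

lemma mul_le_of_add_le {u v d : ℝ} (h0 : 0 ≤ u + v) (h : u + v ≤ 2 * d) :
    u * v ≤ d ^ 2 := by
  nlinarith [sq_nonneg (u - v)]

lemma Good.mul_le {U V : E} {y : M} (h : P.Good U V y) : ‖U‖ * ‖V‖ ≤ P.δ ^ 2 :=
  mul_le_of_add_le (by positivity) h.add_le

lemma Good.norm_mult_le {U V : E} {y ν : M} (h : P.Good U V y)
    (hν : P.C U ν = -P.objGrad U V) : ‖ν‖ ≤ P.mult := by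
  have h1 := h.2.1 ν
  rw [hν, norm_neg] at h1
  have h2 : ‖P.objGrad U V‖ ≤ P.Lf * P.δ + 2 * P.γ * P.δ := by
    refine (norm_add_le _ _).trans ?_
    rw [norm_smul, Real.norm_of_nonneg P.γ_pos.le]
    have h3 := (P.G_bound U V h.mul_le).trans (mul_le_mul_of_nonneg_left h.1 P.Lf_pos.le)
    have h4 : ‖V - U‖ ≤ 2 * P.δ := (norm_sub_le V U).trans (by linarith [h.add_le])
    nlinarith [P.γ_pos]
  rw [mult, le_div_iff₀ P.η_pos]
  linarith

/-- Multipliers at good stationary points are Lipschitz in the factors. -/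
lemma Good.norm_mult_sub_le {U V U' V' : E} {y y' ν ν' : M} (h : P.Good U V y)
    (h' : P.Good U' V' y') (hν : P.C U ν = -P.objGrad U V)
    (hν' : P.C U' ν' = -P.objGrad U' V') :
    P.η * ‖ν' - ν‖ ≤ P.lipU * ‖U' - U‖ + P.lipV * ‖V' - V‖ := by
  have h1 := h.norm_mult_le P hν
  have h2 := P.G_lip U V U' V' h.mul_le h'.mul_le h.1 h'.1
  have h3 : P.C U' (ν' - ν) = -(P.G U' V' - P.G U V) + P.γ • (U' - U) - P.γ • (V' - V)
      - P.C (U' - U) ν := by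
    rw [map_sub, map_sub, _root_.sub_apply, hν, hν', objGrad, objGrad]
    module
  have h4 := h'.2.1 (ν' - ν)
  have h5 := (P.C_bound (U' - U) ν).trans
    (mul_le_mul_of_nonneg_left h1 (mul_nonneg P.a_nonneg (norm_nonneg _)))
  have h6 : ‖P.C U' (ν' - ν)‖ ≤ ‖P.G U' V' - P.G U V‖ + P.γ * ‖U' - U‖ + P.γ * ‖V' - V‖
      + ‖P.C (U' - U) ν‖ := by
    rw [h3]
    refine (norm_sub_le _ _).trans (add_le_add_left ((norm_sub_le _ _).trans
      (add_le_add ((norm_add_le _ _).trans (add_le_add (norm_neg _).le ?_)) ?_)) _) <;>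
    rw [norm_smul, Real.norm_of_nonneg P.γ_pos.le]
  simp only [lipU, lipV]
  linarith

lemma Good.sq_norm_mult_sub_le {U V U' V' : E} {y y' ν ν' : M} (h : P.Good U V y)
    (h' : P.Good U' V' y') (hν : P.C U ν = -P.objGrad U V)
    (hν' : P.C U' ν' = -P.objGrad U' V') :
    P.η ^ 2 * ‖ν' - ν‖ ^ 2 ≤ 2 * P.lipU ^ 2 * (‖U' - U‖ ^ 2 + ‖V' - V‖ ^ 2) := by
  have h1 := h.norm_mult_sub_le P h' hν hν'
  have h2 : P.η * ‖ν' - ν‖ ≤ P.lipU * (‖U' - U‖ + ‖V' - V‖) := by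
    have := mul_le_mul_of_nonneg_right P.lipV_le_lipU (norm_nonneg (V' - V))
    linarith
  have h3 : 0 ≤ P.η * ‖ν' - ν‖ := mul_nonneg P.η_pos.le (norm_nonneg _)
  have h4 := pow_le_pow_left₀ h3 h2 2
  rw [mul_pow, mul_pow] at h4
  refine h4.trans ?_
  have h5 : (‖U' - U‖ + ‖V' - V‖) ^ 2 ≤ 2 * (‖U' - U‖ ^ 2 + ‖V' - V‖ ^ 2) := by
    nlinarith [sq_nonneg (‖U' - U‖ - ‖V' - V‖)]
  nlinarith [mul_le_mul_of_nonneg_left h5 (sq_nonneg P.lipU)]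

lemma Good.sq_norm_mult_sub_le' {U V U' V' : E} {y y' ν ν' : M} (h : P.Good U V y)
    (h' : P.Good U' V' y') (hν : P.C U ν = -P.objGrad U V)
    (hν' : P.C U' ν' = -P.objGrad U' V') :
    ‖ν' - ν‖ ^ 2 ≤ P.ρ * P.γ / 2 * (‖U' - U‖ ^ 2 + ‖V' - V‖ ^ 2) := by
  have h1 := h.sq_norm_mult_sub_le P h' hν hν'
  have h2 := P.lipU_sq_lt
  have h3 : 0 ≤ ‖U' - U‖ ^ 2 + ‖V' - V‖ ^ 2 := by positivity
  have h4 : 0 < P.η ^ 2 := pow_pos P.η_pos 2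
  refine le_of_mul_le_mul_left ?_ h4
  nlinarith

/-- A right inverse of `B U` of norm at most `1 / η`. -/
lemma exists_B_eq [FiniteDimensional ℝ M] {U : E} (h : ∀ x, P.η * ‖x‖ ≤ ‖P.C U x‖) (y : M) :
    ∃ W, P.B U W = y ∧ P.η * ‖W‖ ≤ ‖y‖ := by
  have hC : ∀ x, ‖P.C U x‖ ^ 2 = ⟪x, P.B U (P.C U x)⟫ := fun x => by
    rw [← P.C_adjoint, real_inner_self_eq_norm_sq]
  let T : M →ₗ[ℝ] M := ((P.B U).comp (P.C U)).toLinearMap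
  have hinj : Function.Injective T := by
    rw [injective_iff_map_eq_zero]
    intro x hx
    have h1 : P.B U (P.C U x) = 0 := hx
    have h2 := hC x
    rw [h1, inner_zero_right] at h2
    have h3 := h x
    have h4 : ‖P.C U x‖ = 0 := by simpa using h2
    rw [h4] at h3
    exact norm_le_zero_iff.1 (nonpos_of_mul_nonpos_right h3 P.η_pos)
  obtain ⟨x, hx⟩ := LinearMap.injective_iff_surjective.1 hinj y
  have hx' : P.B U (P.C U x) = y := hx
  refine ⟨P.C U x, hx', ?_⟩
  have h1 := hC x
  rw [hx'] at h1
  have h2 := real_inner_le_norm x y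
  have h3 := h x
  rcases (norm_nonneg (P.C U x)).eq_or_lt with h4 | h4
  · rw [← h4]; simp
  · have h5 : P.η * (‖P.C U x‖ * ‖P.C U x‖) ≤ ‖y‖ * ‖P.C U x‖ := by
      nlinarith [P.η_pos, norm_nonneg y]
    rw [← mul_assoc] at h5
    exact le_of_mul_le_mul_right h5 h4

/-- Below the level `β` the factors stay away from the boundary of the level set: otherwise
rescaling them would leave it. -/
lemma gap_of_pen_lt [Nontrivial M] {U V : E} (h : P.pen U V < P.β) :
    2 * (P.β - P.pen U V) ≤ P.ρ₀ * (2 * P.δ - ‖U‖ - ‖V‖) ^ 2 := by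
  obtain ⟨hU, hV, -⟩ := P.level U V h.le
  have hVpos : 0 < ‖V‖ := by
    rw [pen_symm] at h
    obtain ⟨-, -, hx⟩ := P.level V U h.le
    obtain ⟨x, hx0⟩ := exists_ne (0 : M)
    refine norm_pos_iff.2 fun hV0 => hx0 ?_
    have := hx x
    rw [hV0, map_zero, _root_.zero_apply, norm_zero] at this
    exact norm_le_zero_iff.1 (nonpos_of_mul_nonpos_right this P.η_pos)
  have key : ∀ d ∈ Set.Ioi P.δ,
      2 * (P.β - P.pen U V) ≤ P.ρ₀ * (2 * d - ‖U‖ - ‖V‖) ^ 2 := by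
    intro d hd
    have hd' : P.δ < d := hd
    have hd0 : 0 < d := P.δ_pos.trans hd'
    set s : ℝ := d / ‖V‖ with hs
    have hs0 : 0 < s := div_pos hd0 hVpos
    have h1 : P.β < P.pen (s⁻¹ • U) (s • V) := by
      by_contra hcon
      push Not at hcon
      have h2 := (P.level _ _ hcon).2.1
      rw [norm_smul, Real.norm_of_nonneg hs0.le, hs, div_mul_cancel₀ _ hVpos.ne'] at h2
      linarith
    have h2 : P.res (s⁻¹ • U) (s • V) = P.res U V := by
      simp [res, smul_smul, mul_inv_cancel₀ hs0.ne']
    have h3 : ‖s⁻¹ • U - s • V‖ ^ 2 = ‖U‖ ^ 2 / s ^ 2 - 2 * ⟪U, V⟫ + d ^ 2 := by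
      rw [norm_sub_sq_real, norm_smul, norm_smul, real_inner_smul_left, real_inner_smul_right,
        Real.norm_of_nonneg hs0.le, Real.norm_of_nonneg (inv_nonneg.2 hs0.le), ← mul_assoc s⁻¹,
        inv_mul_cancel₀ hs0.ne', hs, div_mul_cancel₀ _ hVpos.ne']
      field_simp
    have h4 := norm_sub_sq_real U V
    have h5 : ‖U‖ ^ 2 / s ^ 2 + d ^ 2 - ‖U‖ ^ 2 - ‖V‖ ^ 2
        = (d ^ 2 - ‖U‖ ^ 2) * (d ^ 2 - ‖V‖ ^ 2) / d ^ 2 := by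
      rw [hs]; field_simp; ring
    have h6 : (d ^ 2 - ‖U‖ ^ 2) * (d ^ 2 - ‖V‖ ^ 2) / d ^ 2 ≤ (2 * d - ‖U‖ - ‖V‖) ^ 2 := by
      rw [div_le_iff₀ (by positivity)]
      have hp : 0 ≤ d - ‖U‖ := by linarith
      have hq : 0 ≤ d - ‖V‖ := by linarith
      have e1 : (d ^ 2 - ‖U‖ ^ 2) * (d ^ 2 - ‖V‖ ^ 2)
          = ((d - ‖U‖) * (d - ‖V‖)) * ((d + ‖U‖) * (d + ‖V‖)) := by ring
      have e2 : (d + ‖U‖) * (d + ‖V‖) ≤ 2 * d * (2 * d) := by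
        apply mul_le_mul <;> linarith [norm_nonneg U, norm_nonneg V]
      have e3 : 4 * ((d - ‖U‖) * (d - ‖V‖)) ≤ (2 * d - ‖U‖ - ‖V‖) ^ 2 := by
        nlinarith [sq_nonneg (‖U‖ - ‖V‖)]
      rw [e1]
      nlinarith [mul_le_mul_of_nonneg_left e2 (mul_nonneg hp hq),
        mul_le_mul_of_nonneg_right e3 (sq_nonneg d)]
    have h7 : P.ρ₀ / 2 * (‖s⁻¹ • U - s • V‖ ^ 2 - ‖U - V‖ ^ 2)
        ≤ P.ρ₀ / 2 * (2 * d - ‖U‖ - ‖V‖) ^ 2 :=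
      mul_le_mul_of_nonneg_left (by rw [h3, h4]; linarith) (by linarith [P.ρ₀_pos])
    simp only [pen, h2, P.h_scale s hs0.ne'] at h1 ⊢
    linarith
  have hc : Continuous fun d : ℝ => P.ρ₀ * (2 * d - ‖U‖ - ‖V‖) ^ 2 := by fun_prop
  exact ge_of_tendsto ((hc.tendsto P.δ).mono_left nhdsWithin_le_nhds)
    (eventually_nhdsWithin_of_forall key)

/-- An energy estimate at a good stationary point produces a correction of the second factor
inside the level set and makes the norm bound in `Good` strict. -/
lemma Good.improve [FiniteDimensional ℝ M] [Nontrivial M] {U V : E} {y ν : M} (h : P.Good U V y)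
    (hν : P.C U ν = -P.objGrad U V)
    (hE : P.obj U V + ⟪ν, y⟫ + P.ρ₀ / 2 * ‖P.res U V - y‖ ^ 2
      + (P.lipV + 2 * P.ρ₀) * ‖y‖ ^ 2 / P.η ^ 2 < P.β) :
    (∃ W, P.pen U (V + W) < P.β) ∧ ‖U‖ + ‖V‖ + ‖y‖ / P.η < 2 * P.δ := by
  obtain ⟨W, hW, hWn⟩ := P.exists_B_eq h.2.1 (-y)
  have hη := P.η_pos
  rw [norm_neg] at hWn
  have hWn' : ‖W‖ ≤ ‖y‖ / P.η := by rw [le_div_iff₀ hη]; linarith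
  have hres : P.res U (V + W) = P.res U V - y := by
    have := P.res_sub U V (V + W)
    rw [add_sub_cancel_left, hW] at this
    rw [sub_eq_iff_eq_add] at this
    rw [this]; abel
  have hVW := norm_add_le V W
  have hmul : ‖U‖ * ‖V + W‖ ≤ P.δ ^ 2 :=
    mul_le_of_add_le (by positivity) (by linarith [h.2.2])
  have hlip := P.G_lip U V U (V + W) h.mul_le hmul h.1 h.1
  rw [sub_self, norm_zero, mul_zero, zero_add, add_sub_cancel_left] at hlip
  have hg : ⟪P.objGrad U (V + W), W⟫ ≤ ⟪ν, y⟫ + P.lipV * ‖W‖ ^ 2 := by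
    have e1 : P.objGrad U (V + W) = P.objGrad U V + (P.G U (V + W) - P.G U V) + P.γ • W := by
      simp only [objGrad]; module
    have e2 : ⟪P.objGrad U V, W⟫ = ⟪ν, y⟫ := by
      rw [← neg_neg (P.objGrad U V), ← hν, inner_neg_left, P.C_adjoint, hW, inner_neg_right,
        neg_neg]
    have e3 := real_inner_le_norm (P.G U (V + W) - P.G U V) W
    rw [e1, inner_add_left, inner_add_left, e2, real_inner_smul_left, real_inner_self_eq_norm_sq,
      lipV]
    nlinarith [norm_nonneg W]
  have hobj := P.obj_strong U (V + W) V
  rw [sub_add_cancel_left, inner_neg_right, norm_neg] at hobj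
  have hWsq : ‖W‖ ^ 2 ≤ ‖y‖ ^ 2 / P.η ^ 2 := by
    rw [← div_pow]; exact pow_le_pow_left₀ (norm_nonneg _) hWn' 2
  have hpen : P.pen U (V + W) + 2 * P.ρ₀ * (‖y‖ ^ 2 / P.η ^ 2) < P.β := by
    have e1 : P.pen U (V + W) ≤ P.obj U (V + W) + P.ρ₀ / 2 * ‖P.res U V - y‖ ^ 2 := by
      simp only [pen, obj, hres]
      nlinarith [P.ρ₀_lt, sq_nonneg ‖U - (V + W)‖]
    have e2 : P.lipV * ‖W‖ ^ 2 ≤ P.lipV * (‖y‖ ^ 2 / P.η ^ 2) :=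
      mul_le_mul_of_nonneg_left hWsq P.lipV_pos.le
    have e3 : (P.lipV + 2 * P.ρ₀) * ‖y‖ ^ 2 / P.η ^ 2
        = P.lipV * (‖y‖ ^ 2 / P.η ^ 2) + 2 * P.ρ₀ * (‖y‖ ^ 2 / P.η ^ 2) := by ring
    have e4 : 0 ≤ P.γ / 2 * ‖W‖ ^ 2 := by have := P.γ_pos; positivity
    linarith
  have hρ₀ := P.ρ₀_pos
  have hlt : P.pen U (V + W) < P.β := by
    have : 0 ≤ 2 * P.ρ₀ * (‖y‖ ^ 2 / P.η ^ 2) := by positivity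
    linarith
  refine ⟨⟨W, hlt⟩, ?_⟩
  obtain ⟨hU, hVW', -⟩ := P.level _ _ hlt.le
  have hgap := P.gap_of_pen_lt hlt
  have hsq : (2 * (‖y‖ / P.η)) ^ 2 < (2 * P.δ - ‖U‖ - ‖V + W‖) ^ 2 := by
    rw [mul_pow, div_pow]
    have : P.ρ₀ * (2 ^ 2 * (‖y‖ ^ 2 / P.η ^ 2)) < P.ρ₀ * (2 * P.δ - ‖U‖ - ‖V + W‖) ^ 2 := by
      linarith
    exact lt_of_mul_lt_mul_left this hρ₀.le
  have h2 := lt_of_pow_lt_pow_left₀ 2 (by linarith) hsq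
  have h3 : ‖V‖ ≤ ‖V + W‖ + ‖W‖ := by
    have := norm_sub_le (V + W) W
    rwa [add_sub_cancel_right] at this
  linarith

/-- A closed predicate on `[0, 1]` that holds at `0` and propagates to the right holds at `1`. -/
lemma forall_Icc_of_closed {p : ℝ → Prop} (hp : IsClosed {t | p t}) (h0 : p 0)
    (hopen : ∀ t ∈ Set.Icc (0 : ℝ) 1, p t → ∀ᶠ t' in 𝓝 t, p t') :
    ∀ t ∈ Set.Icc (0 : ℝ) 1, p t := by
  have : Set.Icc (0 : ℝ) 1 ⊆ {t | p t} := by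
    refine IsClosed.Icc_subset_of_forall_exists_gt (hp.inter isClosed_Icc) h0 ?_
    rintro x ⟨hx, hx1⟩ y hy
    have h1 := (hopen x ⟨hx1.1, hx1.2.le⟩ hx).filter_mono (nhdsWithin_le_nhds (s := Set.Ioi x))
    obtain ⟨z, hz, hz'⟩ := (h1.and (Ioc_mem_nhdsGT hy)).exists
    exact ⟨z, hz, hz'⟩
  exact fun t ht => this ht

lemma good_path {U V : ℝ → E} {y : ℝ → M} (hU : Continuous U) (hV : Continuous V)
    (hy : Continuous y) (h0 : P.Good (U 0) (V 0) (y 0))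
    (himp : ∀ t ∈ Set.Icc (0 : ℝ) 1, P.Good (U t) (V t) (y t) →
      (∃ W, P.pen (U t) (V t + W) < P.β) ∧ ‖U t‖ + ‖V t‖ + ‖y t‖ / P.η < 2 * P.δ) :
    ∀ t ∈ Set.Icc (0 : ℝ) 1, P.Good (U t) (V t) (y t) := by
  refine forall_Icc_of_closed ?_ h0 ?_
  · have h1 : IsClosed {t | ‖U t‖ ≤ P.δ} := isClosed_le hU.norm continuous_const
    have h2 : IsClosed (⋂ x, {t | P.η * ‖x‖ ≤ ‖P.C (U t) x‖}) := isClosed_iInter fun x =>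
      isClosed_le continuous_const ((P.C.continuous.comp hU).clm_apply continuous_const).norm
    have h3 : IsClosed {t | ‖U t‖ + ‖V t‖ + ‖y t‖ / P.η ≤ 2 * P.δ} :=
      isClosed_le ((hU.norm.add hV.norm).add (hy.norm.div_const _)) continuous_const
    convert h1.inter (h2.inter h3) using 1
    ext t
    simp [Good]
  · intro t ht hg
    obtain ⟨⟨W, hW⟩, hlt⟩ := himp t ht hg
    have hc : Continuous fun t' => P.pen (U t') (V t' + W) :=
      P.continuous_pen.comp (hU.prodMk (hV.add continuous_const))
    have hc' : Continuous fun t' => ‖U t'‖ + ‖V t'‖ + ‖y t'‖ / P.η := by fun_prop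
    filter_upwards [hc.tendsto t (Iio_mem_nhds hW), hc'.tendsto t (Iio_mem_nhds hlt)] with t' h1 h2
    obtain ⟨h3, -, h4⟩ := P.level _ _ (le_of_lt (show P.pen (U t') (V t' + W) < P.β from h1))
    exact ⟨h3, h4, le_of_lt h2⟩

lemma res_segment (U U' V : E) (t : ℝ) :
    P.res (U + t • (U' - U)) V = (1 - t) • P.res U V + t • P.res U' V := by
  simp only [res, map_add, map_smul, map_sub, _root_.add_apply, _root_.smul_apply,
    _root_.sub_apply]
  module

/-- Energy estimate along the segment joining two consecutive first factors. -/
lemma obj_segment_le {U V U' X : E} {ν μ : M} {t : ℝ} (ht : t ∈ Set.Icc (0 : ℝ) 1)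
    (hν : P.C V ν = -P.objGrad V U')
    (hμ : P.C (U + t • (U' - U)) μ = -P.objGrad (U + t • (U' - U)) X) :
    P.obj (U + t • (U' - U)) X + P.γ / 2 * (‖U + t • (U' - U) - U‖ ^ 2 + ‖X - V‖ ^ 2)
      ≤ P.obj U V + t * ⟪ν, P.res U V - P.res U' V⟫
        + ⟪μ, (1 - t) • P.res U V + t • P.res U' V - P.res (U + t • (U' - U)) X⟫ := by
  obtain ⟨ht0, ht1⟩ := ht
  have h1 := P.obj_le_of_stationary hμ V
  rw [P.res_segment, norm_sub_rev] at h1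
  have h2 := P.obj_le_of_stationary hν U
  rw [P.obj_symm V U', P.obj_symm V U, P.res_symm V U, P.res_symm V U', norm_sub_rev] at h2
  have h3 := P.obj_strong V (U + t • (U' - U)) U
  have h4 := P.obj_strong V (U + t • (U' - U)) U'
  have e1 : U - (U + t • (U' - U)) = -(t • (U' - U)) := by abel
  have e2 : U' - (U + t • (U' - U)) = (1 - t) • (U' - U) := by module
  rw [e1, inner_neg_right, norm_neg, norm_smul, mul_pow, Real.norm_eq_abs, sq_abs,
    real_inner_smul_right, P.obj_symm V, P.obj_symm V U] at h3
  rw [e2, norm_smul, mul_pow, Real.norm_eq_abs, sq_abs, real_inner_smul_right, P.obj_symm V,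
    P.obj_symm V U'] at h4
  rw [add_sub_cancel_left, norm_smul, mul_pow, Real.norm_eq_abs, sq_abs]
  have h3' := mul_le_mul_of_nonneg_left h3 (sub_nonneg.2 ht1)
  have h4' := mul_le_mul_of_nonneg_left h4 ht0
  have h2' := mul_le_mul_of_nonneg_left h2 ht0
  have h5 : 0 ≤ P.γ * ‖U' - U‖ ^ 2 * (t * (1 - t)) := by
    have := P.γ_pos
    have : 0 ≤ t * (1 - t) := mul_nonneg ht0 (sub_nonneg.2 ht1)
    positivity
  nlinarith

lemma quad_step {lam s c x : M} {t : ℝ} (ht : t ∈ Set.Icc (0 : ℝ) 1) :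
    t * ⟪lam + c, s - c⟫ + ⟪lam + x, (1 - t) • s + t • c⟫ - ‖x‖ ^ 2
      + 1 / 12 * ‖x + (1 - t) • s‖ ^ 2 ≤ ⟪lam, s⟫ + 1 / 2 * ‖s‖ ^ 2 := by
  obtain ⟨ht0, ht1⟩ := ht
  have hq : 0 ≤ 1 - t := sub_nonneg.2 ht1
  have e1 := mul_nonneg ht0 (sq_nonneg ‖c - (1 / 2 : ℝ) • (s + x)‖)
  have e2 := mul_nonneg hq (sq_nonneg ‖s - (7 / 5 : ℝ) • x‖)
  have e3 := mul_nonneg ht0 (sq_nonneg ‖s - x‖)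
  have e4 := mul_nonneg (mul_nonneg hq ht0) (sq_nonneg ‖s‖)
  have e5 := mul_nonneg hq (sq_nonneg ‖x‖)
  have e6 := mul_nonneg ht0 (sq_nonneg ‖x‖)
  simp only [← real_inner_self_eq_norm_sq, inner_add_left, inner_add_right, inner_sub_left,
    inner_sub_right, real_inner_smul_left, real_inner_smul_right] at *
  rw [real_inner_comm s c, real_inner_comm x c, real_inner_comm x s] at *
  nlinarith

lemma quad_first {lam s c x : M} {t F X N : ℝ} (ht : t ∈ Set.Icc (0 : ℝ) 1)
    (hF : F ≤ X - 1 / 2 * ‖s‖ ^ 2 + ⟪lam, s⟫ - ‖lam‖ ^ 2) (hc : ‖lam + c‖ ^ 2 ≤ N) :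
    F + t * ⟪lam + c, s - c⟫ + t * ⟪lam + x, c⟫ + 1 / 4 * ‖(1 - t) • s‖ ^ 2
      - t * (1 / 6 * ‖x‖ ^ 2) ≤ X + N := by
  obtain ⟨ht0, ht1⟩ := ht
  have hq : 0 ≤ 1 - t := sub_nonneg.2 ht1
  have e1 := mul_nonneg hq (sq_nonneg ‖lam - (1 / 2 : ℝ) • s‖)
  have e2 := mul_nonneg ht0 (sq_nonneg ‖s - ((2 : ℝ) • lam + c)‖)
  have e3 := mul_nonneg ht0 (sq_nonneg ‖x - (3 : ℝ) • c‖)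
  have e4 := mul_nonneg (mul_nonneg hq ht0) (sq_nonneg ‖s‖)
  have e5 := mul_le_mul_of_nonneg_left hc ht0
  have e6 := mul_le_mul_of_nonneg_left hc hq
  have e7 := mul_nonneg hq (sq_nonneg ‖lam + c‖)
  simp only [← real_inner_self_eq_norm_sq, inner_add_left, inner_add_right, inner_sub_left,
    inner_sub_right, real_inner_smul_left, real_inner_smul_right] at *
  rw [real_inner_comm s c, real_inner_comm x c, real_inner_comm lam s,
    real_inner_comm lam c] at *
  nlinarith

lemma quad_homotopy {lam s ν : M} {q F X N : ℝ} (hq : q ∈ Set.Icc (0 : ℝ) 1)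
    (hF : F ≤ X - 1 / 2 * ‖s‖ ^ 2 + ⟪lam, s⟫ - ‖lam‖ ^ 2) (hl : ‖lam‖ ^ 2 ≤ N)
    (hν : ‖ν‖ ^ 2 ≤ N) :
    F + ⟪ν, s - (ν - lam + q • s)⟫ + 1 / 4 * ‖ν - lam + q • s‖ ^ 2 ≤ X + N := by
  obtain ⟨hq0, hq1⟩ := hq
  have hp : 0 ≤ 1 - q := sub_nonneg.2 hq1
  have e1 := mul_nonneg hp (sq_nonneg ‖s - (lam + ν)‖)
  have e2 := mul_nonneg hq0 (sq_nonneg ‖s - (lam + ν)‖)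
  have e3 := mul_nonneg hp (sq_nonneg ‖ν - lam‖)
  have e4 := mul_nonneg hq0 (sq_nonneg ‖ν - lam‖)
  have e5 := mul_nonneg (mul_nonneg hp hq0) (sq_nonneg ‖s‖)
  have e6 := mul_le_mul_of_nonneg_left hl hp
  have e7 := mul_le_mul_of_nonneg_left hν hp
  have e8 := mul_nonneg hq0 ((sq_nonneg ‖ν‖).trans hν)
  simp only [← real_inner_self_eq_norm_sq, inner_add_left, inner_add_right, inner_sub_left,
    inner_sub_right, real_inner_smul_left, real_inner_smul_right] at *
  rw [real_inner_comm lam s, real_inner_comm ν s, real_inner_comm ν lam] at *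
  nlinarith

/-- One iteration, started at a pair `(U, V)` whose second factor is stationary with
multiplier `lam`. -/
structure IsStep (U V : E) (lam : M) (U' V' : E) (lam' : M) : Prop where
  stat : P.C U lam = -P.objGrad U V
  first : P.lagGrad V U' lam = 0
  second : P.lagGrad U' V' lam = 0
  upd : lam' = lam + P.ρ • P.res U' V'

section Step

variable {P} {U V U' V' : E} {lam lam' : M}

lemma IsStep.stat' (hs : P.IsStep U V lam U' V' lam') : P.C U' lam' = -P.objGrad U' V' := by
  rw [hs.upd]; exact P.C_mult_of_lagGrad hs.second

/-- Minimizers along the segment from `U` to `U'`, joining `V` to `V'`; the multipliers are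
written as `lam + x t`. -/
lemma IsStep.exists_path [FiniteDimensional ℝ E] (hs : P.IsStep U V lam U' V' lam') :
    ∃ (X : ℝ → E) (x : ℝ → M), Continuous X ∧ Continuous x ∧ X 0 = V ∧ X 1 = V' ∧ x 0 = 0 ∧
      (∀ t, P.C (U + t • (U' - U)) (lam + x t) = -P.objGrad (U + t • (U' - U)) (X t)) ∧
      ∀ t, P.ρ • P.res (U + t • (U' - U)) (X t) = x t + (1 - t) • P.ρ • P.res U V := by
  set l : ℝ → M := fun t => lam - (1 - t) • P.ρ • P.res U V with hl
  set X : ℝ → E := fun t => P.argV (U + t • (U' - U)) (l t) with hX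
  have hXc : Continuous X :=
    P.continuous_argV.comp (by fun_prop : Continuous fun t : ℝ => (U + t • (U' - U), l t))
  have hrc : Continuous fun t => P.res (U + t • (U' - U)) (X t) :=
    P.continuous_res.comp (by fun_prop : Continuous fun t : ℝ => (U + t • (U' - U), X t))
  have hX0 : X 0 = V := by
    simp only [hX, hl, zero_smul, add_zero, sub_zero, one_smul]
    refine (P.eq_argV ?_).symm
    rw [lagGrad, sub_add_cancel, hs.stat, add_neg_cancel]
  have hX1 : X 1 = V' := by
    simp only [hX, hl, one_smul, sub_self, zero_smul, sub_zero, add_sub_cancel]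
    exact (P.eq_argV hs.second).symm
  refine ⟨X, fun t => P.ρ • P.res (U + t • (U' - U)) (X t) - (1 - t) • P.ρ • P.res U V,
    hXc, by fun_prop, hX0, hX1, ?_, fun t => ?_, fun t => (sub_add_cancel _ _).symm⟩
  · simp [hX0]
  · have := P.C_mult_of_lagGrad (P.lagGrad_argV (U + t • (U' - U)) (l t))
    convert this using 2
    simp only [hl]; abel

/-- Energy estimate along the path of `IsStep.exists_path`. -/
lemma IsStep.energy (hs : P.IsStep U V lam U' V' lam') {t : ℝ} (ht : t ∈ Set.Icc (0 : ℝ) 1)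
    {X : E} {x y z : M} (hg : P.Good U V y) (hg' : P.Good (U + t • (U' - U)) X z)
    (hx : P.C (U + t • (U' - U)) (lam + x) = -P.objGrad (U + t • (U' - U)) X)
    (hr : P.ρ • P.res (U + t • (U' - U)) X = x + (1 - t) • P.ρ • P.res U V) :
    P.ρ * P.obj (U + t • (U' - U)) X + ‖x‖ ^ 2 ≤ P.ρ * P.obj U V
      + t * ⟪lam + P.ρ • P.res U' V, P.ρ • P.res U V - P.ρ • P.res U' V⟫
      + ⟪lam + x, t • P.ρ • P.res U' V - x⟫ := by
  have hν : P.C V (lam + P.ρ • P.res U' V) = -P.objGrad V U' := by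
    rw [P.res_symm U' V]; exact P.C_mult_of_lagGrad hs.first
  have h1 := mul_le_mul_of_nonneg_left (P.obj_segment_le ht hν hx) P.ρ_pos.le
  have h2 := hg.sq_norm_mult_sub_le' P hg' hs.stat hx
  rw [add_sub_cancel_left] at h2
  have h3 : P.ρ * ⟪lam + P.ρ • P.res U' V, P.res U V - P.res U' V⟫
      = ⟪lam + P.ρ • P.res U' V, P.ρ • P.res U V - P.ρ • P.res U' V⟫ := by
    rw [← smul_sub, real_inner_smul_right]
  have h4 : P.ρ * ⟪lam + x, (1 - t) • P.res U V + t • P.res U' V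
        - P.res (U + t • (U' - U)) X⟫ = ⟪lam + x, t • P.ρ • P.res U' V - x⟫ := by
    rw [← real_inner_smul_right, smul_sub, hr]
    congr 1; module
  rw [← h3, ← h4]
  linarith

lemma rho_mul_lag (U V : E) (lam : M) : P.ρ * P.lag U V lam
    = P.ρ * P.obj U V + ⟪lam, P.ρ • P.res U V⟫ + 1 / 2 * ‖P.ρ • P.res U V‖ ^ 2 := by
  rw [lag, norm_smul, mul_pow, Real.norm_eq_abs, sq_abs, real_inner_smul_right]; ring

/-- `Good.improve` with everything multiplied by `ρ`. -/
lemma Good.improve' [FiniteDimensional ℝ M] [Nontrivial M]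
    (h12 : 12 * (P.lipV + 2 * P.ρ₀) ≤ P.ρ * P.η ^ 2) {y ν w : M} (h : P.Good U V y)
    (hν : P.C U ν = -P.objGrad U V) (hw : P.ρ • P.res U V = P.ρ • y + w)
    (hE : P.ρ * P.obj U V + ⟪ν, P.ρ • y⟫ + 1 / 4 * ‖w‖ ^ 2 + 1 / 12 * ‖P.ρ • y‖ ^ 2
      < P.ρ * P.β) :
    (∃ W, P.pen U (V + W) < P.β) ∧ ‖U‖ + ‖V‖ + ‖y‖ / P.η < 2 * P.δ := by
  have hρ := P.ρ_pos
  refine h.improve P hν (lt_of_mul_lt_mul_left (lt_of_le_of_lt ?_ hE) hρ.le)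
  have hw' : w = P.ρ • (P.res U V - y) := by rw [smul_sub, hw]; abel
  have h1 : P.ρ * (P.ρ₀ / 2 * ‖P.res U V - y‖ ^ 2) ≤ 1 / 4 * ‖w‖ ^ 2 := by
    rw [hw', norm_smul, mul_pow, Real.norm_eq_abs, sq_abs]
    have := P.two_ρ₀_lt
    have h2 : P.ρ * (P.ρ₀ / 2) ≤ 1 / 4 * P.ρ ^ 2 := by nlinarith
    nlinarith [mul_le_mul_of_nonneg_right h2 (sq_nonneg ‖P.res U V - y‖)]
  have h2 : P.ρ * ((P.lipV + 2 * P.ρ₀) * ‖y‖ ^ 2 / P.η ^ 2) ≤ 1 / 12 * ‖P.ρ • y‖ ^ 2 := by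
    rw [norm_smul, mul_pow, Real.norm_eq_abs, sq_abs, ← mul_div_assoc,
      div_le_iff₀ (pow_pos P.η_pos 2)]
    have h3 : 0 ≤ P.ρ * ‖y‖ ^ 2 := by positivity
    nlinarith [mul_le_mul_of_nonneg_right h12 h3]
  rw [real_inner_smul_right]
  linarith

/-- Goodness is preserved by a step as long as the augmented Lagrangian is below `β`. -/
lemma IsStep.good [FiniteDimensional ℝ E] [FiniteDimensional ℝ M] [Nontrivial M]
    (h12 : 12 * (P.lipV + 2 * P.ρ₀) ≤ P.ρ * P.η ^ 2)
    (hs : P.IsStep U V lam U' V' lam') (hg : P.Good U V (P.res U V))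
    (hL : P.lag U V lam < P.β) : P.Good U' V' (P.res U' V') := by
  obtain ⟨X, x, hX, hx, hX0, hX1, hx0, hst, hr⟩ := hs.exists_path
  have hUc : Continuous fun t : ℝ => U + t • (U' - U) := by fun_prop
  have hgood := P.good_path hUc hX (P.continuous_res.comp (hUc.prodMk hX)) (by simpa [hX0]) ?_ 1
    ⟨zero_le_one, le_rfl⟩
  · simpa [hX1] using hgood
  intro t ht hgt
  refine hgt.improve' h12 (hst t) (w := 0) (add_zero _).symm ?_
  have h1 := hs.energy ht hg hgt (hst t) (hr t)
  have h2 := quad_step (lam := lam) (s := P.ρ • P.res U V) (c := P.ρ • P.res U' V) (x := x t) ht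
  have h3 := mul_lt_mul_of_pos_left hL P.ρ_pos
  rw [rho_mul_lag] at h3
  simp only [Function.comp_apply]
  rw [hr t, norm_zero]
  rw [inner_sub_right (lam + x t)] at h1
  rw [inner_add_right (lam + x t)] at h2 ⊢
  linarith

/-- Descent of the augmented Lagrangian over a step between good points. -/
lemma IsStep.descent {y z : M} (hs : P.IsStep U V lam U' V' lam') (hg : P.Good U V y)
    (hg' : P.Good U' V' z) :
    P.lag U' V' lam' + (P.γ / 2 - 2 * P.lipU ^ 2 / (P.η ^ 2 * P.ρ))
      * (‖U' - U‖ ^ 2 + ‖V' - V‖ ^ 2) ≤ P.lag U V lam := by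
  have h1 := P.lag_strong V U' U lam
  rw [hs.first, inner_zero_left, P.lag_symm V U', P.lag_symm V U, norm_sub_rev] at h1
  have h2 := P.lag_strong U' V' V lam
  rw [hs.second, inner_zero_left, norm_sub_rev] at h2
  have h3 := hg.sq_norm_mult_sub_le P hg' hs.stat hs.stat'
  have h4 : P.lag U' V' lam' = P.lag U' V' lam + ‖lam' - lam‖ ^ 2 / P.ρ := by
    rw [hs.upd, add_sub_cancel_left, lag, lag, inner_add_left, norm_smul, mul_pow,
      Real.norm_eq_abs, sq_abs, real_inner_smul_left, real_inner_self_eq_norm_sq]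
    have := P.ρ_pos
    field_simp
    ring
  have hη : 0 < P.η ^ 2 := pow_pos P.η_pos 2
  have h5 : ‖lam' - lam‖ ^ 2 / P.ρ ≤ 2 * P.lipU ^ 2 / (P.η ^ 2 * P.ρ)
      * (‖U' - U‖ ^ 2 + ‖V' - V‖ ^ 2) := by
    rw [div_le_iff₀ P.ρ_pos]
    have h6 : 2 * P.lipU ^ 2 / (P.η ^ 2 * P.ρ) * (‖U' - U‖ ^ 2 + ‖V' - V‖ ^ 2) * P.ρ
        = 2 * P.lipU ^ 2 * (‖U' - U‖ ^ 2 + ‖V' - V‖ ^ 2) / P.η ^ 2 := by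
      have := P.ρ_pos
      field_simp
    rw [h6, le_div_iff₀ hη]
    linarith
  linarith

lemma descent_pos : 0 < P.γ / 2 - 2 * P.lipU ^ 2 / (P.η ^ 2 * P.ρ) := by
  have h1 := P.lipU_sq_lt
  have hη : 0 < P.η ^ 2 * P.ρ := mul_pos (pow_pos P.η_pos 2) P.ρ_pos
  rw [sub_pos, div_lt_iff₀ hη]
  nlinarith

lemma rho_obj_le_of_lag {β₀ : ℝ}
    (h : P.lag U V (lam - P.ρ • P.res U V) + ‖lam - P.ρ • P.res U V‖ ^ 2 / P.ρ ≤ β₀) :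
    P.ρ * P.obj U V ≤ P.ρ * β₀ - 1 / 2 * ‖P.ρ • P.res U V‖ ^ 2 + ⟪lam, P.ρ • P.res U V⟫
      - ‖lam‖ ^ 2 := by
  have h1 := mul_le_mul_of_nonneg_left h P.ρ_pos.le
  rw [mul_add, rho_mul_lag, mul_div_cancel₀ _ P.ρ_pos.ne', norm_sub_sq_real, inner_sub_left,
    real_inner_self_eq_norm_sq] at h1
  linarith

/-- The multiplier after the first-factor update is bounded when the pair `(U, V)` comes from
an initial point with small augmented Lagrangian. -/
lemma IsStep.norm_first_mult_le [FiniteDimensional ℝ E] (hs : P.IsStep U V lam U' V' lam')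
    (h : P.lag U V (lam - P.ρ • P.res U V) + ‖lam - P.ρ • P.res U V‖ ^ 2 / P.ρ ≤ P.β₀)
    (hlam : ‖lam‖ ≤ P.mult) : ‖lam + P.ρ • P.res U' V‖ ≤ P.mult := by
  set s := P.ρ • P.res U V with hsdef
  set l : ℝ → M := fun t => lam - (1 - t) • s with hl
  set X : ℝ → E := fun t => P.argV V (l t) with hX
  have hXc : Continuous X :=
    P.continuous_argV.comp (by fun_prop : Continuous fun t : ℝ => (V, l t))
  have hν : ∀ t, P.C V (l t + P.ρ • P.res V (X t)) = -P.objGrad V (X t) := fun t =>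
    P.C_mult_of_lagGrad (P.lagGrad_argV V (l t))
  have hpc : Continuous fun t => P.pen V (X t) :=
    P.continuous_pen.comp (continuous_const.prodMk hXc)
  have hF := rho_obj_le_of_lag h
  have hββ : P.β₀ < P.β := by
    have := P.mult_sq_lt
    have h1 : 0 < P.ρ * (P.β - P.β₀) := lt_of_le_of_lt (sq_nonneg _) this
    linarith [pos_of_mul_pos_right h1 P.ρ_pos.le]
  have hbound : ∀ t, P.pen V (X t) ≤ P.β → ‖l t + P.ρ • P.res V (X t)‖ ≤ P.mult := fun t ht =>
    (P.good_of_pen ht).norm_mult_le P (hν t)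
  have hall : ∀ t ∈ Set.Icc (0 : ℝ) 1, P.pen V (X t) ≤ P.β := by
    refine forall_Icc_of_closed (isClosed_le hpc continuous_const) ?_ ?_
    · have h1 := P.pen_le_lag V (X 0) (lam - s)
      have h2 := P.lag_argV_le V U (lam - s)
      have h3 : X 0 = P.argV V (lam - s) := by simp [hX, hl]
      rw [P.lag_symm V U, ← h3] at h2
      linarith
    · intro t ht hpt
      have hq : 1 - t ∈ Set.Icc (0 : ℝ) 1 := ⟨by linarith [ht.2], by linarith [ht.1]⟩
      have hb := hbound t hpt
      have h1 := pow_le_pow_left₀ (norm_nonneg _) hb 2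
      have h2 := pow_le_pow_left₀ (norm_nonneg _) hlam 2
      have h3 := quad_homotopy hq hF h2 h1
      have h4 : l t + P.ρ • P.res V (X t) - lam + (1 - t) • s = P.ρ • P.res V (X t) := by
        simp only [hl]; abel
      rw [← hsdef, h4] at h3
      have h5 := mul_le_mul_of_nonneg_left (P.obj_le_of_stationary (hν t) U) P.ρ_pos.le
      have hγ : 0 ≤ P.γ / 2 * ‖U - X t‖ ^ 2 := by have := P.γ_pos; positivity
      have h6 : P.ρ * ⟪l t + P.ρ • P.res V (X t), P.res V U - P.res V (X t)⟫
          = ⟪l t + P.ρ • P.res V (X t), s - P.ρ • P.res V (X t)⟫ := by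
        rw [← real_inner_smul_right, smul_sub, hsdef, P.res_symm U V]
      have h7 : P.ρ * P.pen V (X t) ≤ P.ρ * P.obj V (X t)
          + 1 / 4 * ‖P.ρ • P.res V (X t)‖ ^ 2 := by
        rw [norm_smul, mul_pow, Real.norm_eq_abs, sq_abs]
        have h8 : P.pen V (X t) ≤ P.obj V (X t) + P.ρ / 4 * ‖P.res V (X t)‖ ^ 2 := by
          simp only [pen, obj]
          nlinarith [P.ρ₀_lt, P.two_ρ₀_lt, sq_nonneg ‖V - X t‖, sq_nonneg ‖P.res V (X t)‖]
        nlinarith [P.ρ_pos]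
      have h9 : P.ρ * P.pen V (X t) < P.ρ * P.β := by
        rw [P.obj_symm V U] at h5
        have := P.mult_sq_lt
        have := mul_nonneg P.ρ_pos.le hγ
        linarith
      have h10 : P.pen V (X t) < P.β := lt_of_mul_lt_mul_left h9 P.ρ_pos.le
      filter_upwards [hpc.tendsto t (Iio_mem_nhds h10)] with t' ht'
      exact le_of_lt ht'
  have h1 := hbound 1 (hall 1 ⟨zero_le_one, le_rfl⟩)
  have h2 : X 1 = U' := by
    simp only [hX, hl, sub_self, zero_smul, sub_zero]
    exact (P.eq_argV hs.first).symm
  rw [h2, P.res_symm V U'] at h1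
  simpa [hl] using h1

/-- The first regular step, from a pair in the initial level set. -/
lemma IsStep.good_of_init [FiniteDimensional ℝ E] [FiniteDimensional ℝ M] [Nontrivial M]
    (hs : P.IsStep U V lam U' V' lam')
    (h : P.lag U V (lam - P.ρ • P.res U V) + ‖lam - P.ρ • P.res U V‖ ^ 2 / P.ρ ≤ P.β₀) :
    P.Good U' V' (P.res U' V') ∧ P.lag U' V' lam' < P.β := by
  have hββ : P.ρ * P.β₀ + P.mult ^ 2 < P.ρ * P.β := by linarith [P.mult_sq_lt]
  have hββ' : P.β₀ ≤ P.β :=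
    le_of_mul_le_mul_left (by linarith [sq_nonneg P.mult]) P.ρ_pos
  have hpen : P.pen U V ≤ P.β := (P.pen_le_lag U V _).trans (h.trans hββ')
  have h12 := P.twelve_mul_le hpen
  have hg := P.good_of_pen hpen
  have hlam := hg.norm_mult_le P hs.stat
  have hmult := pow_le_pow_left₀ (norm_nonneg _) (hs.norm_first_mult_le h hlam) 2
  have hF := rho_obj_le_of_lag h
  obtain ⟨X, x, hX, hx, hX0, hX1, hx0, hst, hr⟩ := hs.exists_path
  have hUc : Continuous fun t : ℝ => U + t • (U' - U) := by fun_prop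
  have hρ := P.ρ_pos
  have hsm : ∀ t, P.ρ • P.ρ⁻¹ • x t = x t := fun t => smul_inv_smul₀ hρ.ne' _
  have hest : ∀ t ∈ Set.Icc (0 : ℝ) 1, P.Good (U + t • (U' - U)) (X t) (P.ρ⁻¹ • x t) →
      P.ρ * P.obj (U + t • (U' - U)) (X t) + ⟪lam + x t, x t⟫
        + 1 / 4 * ‖(1 - t) • P.ρ • P.res U V‖ ^ 2 + 5 / 6 * ‖x t‖ ^ 2 < P.ρ * P.β := by
    intro t ht hgt
    have h1 := hs.energy ht hg hgt (hst t) (hr t)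
    have h2 := quad_first (x := x t) ht hF hmult
    rw [inner_sub_right (lam + x t), real_inner_smul_right] at h1
    nlinarith [mul_nonneg (sub_nonneg.2 ht.2) (sq_nonneg ‖x t‖)]
  have hgood := P.good_path hUc hX (y := fun t => P.ρ⁻¹ • x t) (by fun_prop)
    (by simpa [hX0, hx0]) ?_
  · have h1 : (1 : ℝ) ∈ Set.Icc (0 : ℝ) 1 := ⟨zero_le_one, le_rfl⟩
    have hg1 := hgood 1 h1
    have he1 := hest 1 h1 hg1
    have hr1 := hr 1
    have hU1 : U + (1 : ℝ) • (U' - U) = U' := by simp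
    rw [hU1, hX1, sub_self, zero_smul, add_zero] at hr1
    simp only [hU1, hX1, ← hr1, inv_smul_smul₀ hρ.ne', sub_self, zero_smul, norm_zero]
      at hg1 he1
    refine ⟨hg1, lt_of_mul_lt_mul_left (lt_of_le_of_lt ?_ he1) hρ.le⟩
    rw [rho_mul_lag, hs.upd]
    have := sq_nonneg ‖P.ρ • P.res U' V'‖
    linarith
  · intro t ht hgt
    refine hgt.improve' h12 (hst t) (w := (1 - t) • P.ρ • P.res U V) (by rw [hsm, hr]) ?_
    rw [hsm]
    have := hest t ht hgt
    have := sq_nonneg ‖x t‖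
    linarith

end Step

/-- Linear convergence of a bounded descent sequence under a Łojasiewicz inequality with exponent
at most `1 / 2` at every zero of the gradient norm `N`. -/
lemma exists_linear_rate_of_descent {X : Type*} [PseudoMetricSpace X] [ProperSpace X] {Φ N : X → ℝ}
    (hΦ : Continuous Φ) (hN : Continuous N) {z : ℕ → X} {w : ℕ → ℝ} {κ c₁ c₂ c δc α : ℝ}
    (hκ : 0 < κ) (hc₁ : 0 ≤ c₁) (hc₂ : 0 ≤ c₂) (hδc : 0 < δc) (hα0 : 0 < α) (hα1 : α ≤ 1 / 2)
    (hw : ∀ k, 0 ≤ w k) (hz : Bornology.IsBounded (Set.range z))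
    (hdesc : ∀ k, Φ (z (k + 1)) + κ * w k ≤ Φ (z k))
    (hstep : ∀ k, dist (z k) (z (k + 1)) ^ 2 ≤ c₁ * w k)
    (hgrad : ∀ k, N (z (k + 1)) ^ 2 ≤ c₂ * w k)
    (hLoj : ∀ p q, N q = 0 → dist p q ≤ δc → |Φ p - Φ q| ^ α ≤ c * N p) :
    ∃ (k₀ : ℕ) (q : X) (ξ μ : ℝ), N q = 0 ∧ 0 < ξ ∧ 0 ≤ μ ∧ μ < 1 ∧
      ∀ k, dist (z (k₀ + k)) q ≤ ξ * μ ^ k := by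
  have hanti : Antitone fun k => Φ (z k) :=
    antitone_nat_of_succ_le fun k => by linarith [hdesc k, mul_nonneg hκ.le (hw k)]
  have hcomp : IsCompact (closure (Set.range z)) := hz.isCompact_closure
  have hbdd : BddBelow (Set.range fun k => Φ (z k)) := by
    refine (hcomp.image hΦ).bddBelow.mono ?_
    rintro _ ⟨k, rfl⟩
    exact ⟨z k, subset_closure ⟨k, rfl⟩, rfl⟩
  set l := ⨅ k, Φ (z k) with hl
  have hlim : Tendsto (fun k => Φ (z k)) atTop (𝓝 l) := tendsto_atTop_ciInf hanti hbdd
  have hle : ∀ k, l ≤ Φ (z k) := fun k => ciInf_le hbdd k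
  have hlim' : Tendsto (fun k => Φ (z k) - Φ (z (k + 1))) atTop (𝓝 0) := by
    simpa using hlim.sub (hlim.comp (tendsto_add_atTop_nat 1))
  have hN0 : Tendsto (fun k => N (z k) ^ 2) atTop (𝓝 0) := by
    rw [← tendsto_add_atTop_iff_nat 1]
    refine squeeze_zero (fun _ => sq_nonneg _) (g := fun k => c₂ / κ * (Φ (z k) - Φ (z (k + 1))))
      (fun k => ?_) (by simpa using hlim'.const_mul (c₂ / κ))
    refine (hgrad k).trans ?_
    rw [div_mul_eq_mul_div, le_div_iff₀ hκ]
    nlinarith [hdesc k, mul_le_mul_of_nonneg_left (hdesc k) hc₂]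
  have hcluster : ∀ {φ : ℕ → ℕ} {q : X}, StrictMono φ → Tendsto (z ∘ φ) atTop (𝓝 q) →
      N q = 0 ∧ Φ q = l := by
    intro φ q hφ hq
    have h1 : Tendsto (fun k => N (z (φ k)) ^ 2) atTop (𝓝 (N q ^ 2)) :=
      ((hN.tendsto q).comp hq).pow 2
    have h2 := tendsto_nhds_unique h1 (hN0.comp hφ.tendsto_atTop)
    exact ⟨pow_eq_zero_iff two_ne_zero |>.1 h2,
      tendsto_nhds_unique ((hΦ.tendsto q).comp hq) (hlim.comp hφ.tendsto_atTop)⟩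
  have hnear : ∀ᶠ k in atTop, ∃ q, N q = 0 ∧ Φ q = l ∧ dist (z k) q ≤ δc := by
    by_contra hcon
    obtain ⟨φ, hφ, hφ'⟩ := extraction_of_frequently_atTop (not_eventually.1 hcon)
    obtain ⟨q, -, ψ, hψ, hq⟩ := hcomp.tendsto_subseq (x := z ∘ φ)
      fun n => subset_closure ⟨φ n, rfl⟩
    obtain ⟨h1, h2⟩ := hcluster (hφ.comp hψ) hq
    obtain ⟨n, hn⟩ := (hq.eventually (Metric.closedBall_mem_nhds q hδc)).exists
    exact hφ' (ψ n) ⟨q, h1, h2, hn⟩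
  have hone : ∀ᶠ k in atTop, Φ (z k) < l + 1 := hlim (Iio_mem_nhds (by linarith))
  obtain ⟨K, hK⟩ := eventually_atTop.1 (hnear.and hone)
  set H := c ^ 2 * c₂ / κ with hH
  have hH0 : 0 ≤ H := by positivity
  set θ := H / (1 + H) with hθ
  have hθ0 : 0 ≤ θ := by positivity
  have hθ1 : θ < 1 := by rw [hθ, div_lt_one (by linarith)]; linarith
  have hcontr : ∀ j, Φ (z (K + (j + 1))) - l ≤ θ * (Φ (z (K + j)) - l) := by
    intro j
    obtain ⟨⟨q, hq0, hql, hqd⟩, h1⟩ := hK (K + (j + 1)) (by omega)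
    have h2 := hLoj _ q hq0 hqd
    set e := Φ (z (K + (j + 1))) - l with he
    have he0 : 0 ≤ e := sub_nonneg.2 (hle _)
    rw [hql, abs_of_nonneg he0] at h2
    have h3 : e ≤ (e ^ α) ^ 2 := by
      rw [← Real.rpow_mul_natCast he0]
      calc e = e ^ (1 : ℝ) := (Real.rpow_one e).symm
        _ ≤ _ := Real.rpow_le_rpow_of_exponent_ge' he0 (by linarith) (by positivity)
            (by push_cast; linarith)
    have h4 := pow_le_pow_left₀ (Real.rpow_nonneg he0 α) h2 2
    rw [mul_pow] at h4
    have h5 := hgrad (K + j)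
    have h6 := hdesc (K + j)
    rw [add_assoc] at h5 h6
    have h7 : e ≤ H * (Φ (z (K + j)) - l - e) := by
      have h8 : c ^ 2 * N (z (K + (j + 1))) ^ 2 ≤ H * (κ * w (K + j)) := by
        have : H * (κ * w (K + j)) = c ^ 2 * (c₂ * w (K + j)) := by rw [hH]; field_simp
        rw [this]
        exact mul_le_mul_of_nonneg_left h5 (sq_nonneg c)
      have h9 := mul_le_mul_of_nonneg_left
        (show κ * w (K + j) ≤ Φ (z (K + j)) - l - e by rw [he]; linarith) hH0
      linarith
    rw [hθ, div_mul_eq_mul_div, le_div_iff₀ (by linarith)]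
    linarith
  have hgeom : ∀ j, Φ (z (K + j)) - l ≤ θ ^ j := by
    intro j
    induction j with
    | zero =>
      rw [pow_zero, add_zero]
      linarith [(hK K le_rfl).2]
    | succ j ih =>
      rw [pow_succ']
      exact (hcontr j).trans (mul_le_mul_of_nonneg_left ih hθ0)
  have hdist : ∀ j, dist (z (K + j)) (z (K + (j + 1))) ≤ √(c₁ / κ) * √θ ^ j := by
    intro j
    refine le_of_sq_le_sq ?_ (by positivity)
    rw [mul_pow, ← pow_mul, mul_comm j 2, pow_mul, Real.sq_sqrt hθ0,
      Real.sq_sqrt (div_nonneg hc₁ hκ.le)]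
    refine (hstep (K + j)).trans ?_
    rw [div_mul_eq_mul_div, le_div_iff₀ hκ, mul_assoc]
    refine mul_le_mul_of_nonneg_left ?_ hc₁
    linarith [hdesc (K + j), hle (K + j + 1), hgeom j]
  have hμ1 : √θ < 1 := by rw [Real.sqrt_lt' one_pos]; simpa using hθ1
  have hcauchy := cauchySeq_of_le_geometric (√θ) (√(c₁ / κ)) hμ1 hdist
  obtain ⟨q, hq⟩ := cauchySeq_tendsto_of_complete hcauchy
  have hφ : StrictMono fun j => K + j := fun _ _ h => Nat.add_lt_add_left h K
  refine ⟨K, q, √(c₁ / κ) / (1 - √θ) + 1, √θ, (hcluster hφ hq).1, ?_, Real.sqrt_nonneg _, hμ1,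
    fun k => ?_⟩
  · have := sub_pos.2 hμ1
    positivity
  · have h1 := dist_le_of_le_geometric_of_tendsto (√θ) (√(c₁ / κ)) hμ1 hdist hq k
    have h2 : 0 ≤ √θ ^ k := by positivity
    calc _ ≤ _ := h1
      _ = √(c₁ / κ) / (1 - √θ) * √θ ^ k := by ring
      _ ≤ _ := by nlinarith

/-- The ADMM iteration for the model. -/
structure IsADMM (U V : ℕ → E) (lam : ℕ → M) : Prop where
  min_first : ∀ k U', P.lag (U (k + 1)) (V k) (lam k) ≤ P.lag U' (V k) (lam k)
  min_second : ∀ k V', P.lag (U (k + 1)) (V (k + 1)) (lam k) ≤ P.lag (U (k + 1)) V' (lam k)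
  upd : ∀ k, lam (k + 1) = lam k + P.ρ • P.res (U (k + 1)) (V (k + 1))
  init : P.lag (U 0) (V 0) (lam 0) + ‖lam 0‖ ^ 2 / P.ρ ≤ P.β₀

/-- Norm of the full gradient of the augmented Lagrangian. -/
def gradNorm (p : E × E × M) : ℝ :=
  √(‖P.lagGrad p.2.1 p.1 p.2.2‖ ^ 2 + ‖P.lagGrad p.1 p.2.1 p.2.2‖ ^ 2
    + ‖P.res p.1 p.2.1‖ ^ 2)

lemma continuous_gradNorm : Continuous P.gradNorm := by
  have h1 : Continuous fun p : E × E × M => P.lagGrad p.2.1 p.1 p.2.2 :=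
    P.continuous_lagGrad.comp (by fun_prop : Continuous fun p : E × E × M => (p.2.1, p.1, p.2.2))
  have h2 := P.continuous_lagGrad
  have h3 : Continuous fun p : E × E × M => P.res p.1 p.2.1 :=
    P.continuous_res.comp (by fun_prop : Continuous fun p : E × E × M => (p.1, p.2.1))
  unfold gradNorm; fun_prop

lemma B_bound (U V : E) : ‖P.B U V‖ ≤ P.a * ‖U‖ * ‖V‖ := by
  have h1 := real_inner_le_norm (P.C U (P.B U V)) V
  rw [P.C_adjoint, real_inner_self_eq_norm_sq] at h1
  have h2 := mul_le_mul_of_nonneg_right (P.C_bound U (P.B U V)) (norm_nonneg V)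
  rcases (norm_nonneg (P.B U V)).eq_or_lt with h | h
  · rw [← h]
    exact mul_nonneg (mul_nonneg P.a_nonneg (norm_nonneg _)) (norm_nonneg _)
  · nlinarith

/-- On bounded sets the gradient after a step is controlled by the length of the step. -/
lemma exists_gradNorm_le (R : ℝ) (hR : 0 ≤ R) : ∃ c, 0 ≤ c ∧ ∀ U V U' V' : E, ∀ lam lam' : M,
    P.IsStep U V lam U' V' lam' → ‖V‖ ≤ R → ‖U'‖ ≤ R → ‖V'‖ ≤ R → ‖lam‖ ≤ R → ‖lam'‖ ≤ R →
    P.gradNorm (U', V', lam') ^ 2 ≤ c * (‖V' - V‖ ^ 2 + ‖lam' - lam‖ ^ 2) := by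
  obtain ⟨K, hK0, hK⟩ := P.G_lip_bdd R
  have hρ := P.ρ_pos
  have hγ := P.γ_pos
  have ha := P.a_nonneg
  set c₁ := K + P.γ + 3 * P.a * R + P.a * R * (P.ρ * (P.a * R)) with hc₁
  refine ⟨2 * c₁ ^ 2 + 3 * (P.a * R) ^ 2 + 1 / P.ρ ^ 2, by positivity, ?_⟩
  intro U V U' V' lam lam' hs hV hU' hV' hl hl'
  have hres : P.ρ • P.res U' V' = lam' - lam := by rw [hs.upd]; abel
  have h1 : P.lagGrad U' V' lam' = P.C U' (lam' - lam) := by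
    rw [lagGrad, ← sub_zero (P.objGrad U' V' + _), ← hs.second, lagGrad, add_sub_add_left_eq_sub,
      ← map_sub, add_sub_add_right_eq_sub]
  have h1' : ‖P.lagGrad U' V' lam'‖ ≤ P.a * R * ‖lam' - lam‖ := by
    rw [h1]
    refine (P.C_bound _ _).trans ?_
    gcongr
  have h2 : P.lagGrad V' U' lam' = (P.G V' U' - P.G V U') - P.γ • (V' - V)
      + P.C (V' - V) (lam' + (lam' - lam))
      + P.C V ((lam' - lam) + P.ρ • P.B U' (V' - V)) := by
    have e1 : P.ρ • P.res U' V = lam' - lam - P.ρ • P.B U' (V' - V) := by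
      rw [← P.res_sub, smul_sub, hres]; abel
    rw [← sub_zero (P.lagGrad V' U' lam'), ← hs.first, lagGrad, lagGrad, objGrad, objGrad,
      P.res_symm V' U', P.res_symm V U', hres, e1]
    simp only [map_add, map_sub, _root_.sub_apply]
    module
  have h3 : ‖lam' + (lam' - lam)‖ ≤ 3 * R := by
    have := norm_add_le lam' (lam' - lam)
    have := norm_sub_le lam' lam
    linarith
  have h4 : ‖(lam' - lam) + P.ρ • P.B U' (V' - V)‖
      ≤ ‖lam' - lam‖ + P.ρ * (P.a * R * ‖V' - V‖) := by
    refine (norm_add_le _ _).trans ?_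
    rw [norm_smul, Real.norm_of_nonneg hρ.le]
    have := (P.B_bound U' (V' - V)).trans
      (by gcongr : P.a * ‖U'‖ * ‖V' - V‖ ≤ P.a * R * ‖V' - V‖)
    gcongr
  have h5 : ‖P.lagGrad V' U' lam'‖ ≤ c₁ * ‖V' - V‖ + P.a * R * ‖lam' - lam‖ := by
    have e1 := hK V V' U' hV hV' hU'
    have e2 : ‖P.C (V' - V) (lam' + (lam' - lam))‖ ≤ P.a * ‖V' - V‖ * (3 * R) :=
      (P.C_bound _ _).trans (by gcongr)
    have e3 : ‖P.C V ((lam' - lam) + P.ρ • P.B U' (V' - V))‖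
        ≤ P.a * R * (‖lam' - lam‖ + P.ρ * (P.a * R * ‖V' - V‖)) :=
      (P.C_bound _ _).trans (by gcongr)
    have e4 : ‖P.γ • (V' - V)‖ = P.γ * ‖V' - V‖ := by
      rw [norm_smul, Real.norm_of_nonneg hγ.le]
    have e5 := norm_add_le (P.G V' U' - P.G V U' - P.γ • (V' - V)
      + P.C (V' - V) (lam' + (lam' - lam))) (P.C V ((lam' - lam) + P.ρ • P.B U' (V' - V)))
    have e6 := norm_add_le (P.G V' U' - P.G V U' - P.γ • (V' - V))
      (P.C (V' - V) (lam' + (lam' - lam)))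
    have e7 := norm_sub_le (P.G V' U' - P.G V U') (P.γ • (V' - V))
    rw [h2, hc₁]
    linarith
  have h6 : ‖P.res U' V'‖ ^ 2 = 1 / P.ρ ^ 2 * ‖lam' - lam‖ ^ 2 := by
    rw [← hres, norm_smul, mul_pow, Real.norm_eq_abs, sq_abs]
    field_simp
  have h7 := pow_le_pow_left₀ (norm_nonneg _) h1' 2
  have h8 := pow_le_pow_left₀ (norm_nonneg _) h5 2
  rw [gradNorm, Real.sq_sqrt (by positivity), h6]
  have h9 : 0 ≤ c₁ ^ 2 * ‖lam' - lam‖ ^ 2 := by positivity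
  have h10 : 0 ≤ (P.a * R) ^ 2 * ‖V' - V‖ ^ 2 := by positivity
  have h11 : 0 ≤ 1 / P.ρ ^ 2 * ‖V' - V‖ ^ 2 := by positivity
  nlinarith [sq_nonneg (c₁ * ‖V' - V‖ - P.a * R * ‖lam' - lam‖)]

namespace IsADMM

variable {P} {U V : ℕ → E} {lam : ℕ → M}

lemma first_le (hA : P.IsADMM U V lam) (k : ℕ) :
    P.lag (U (k + 1)) (V (k + 1)) (lam k) ≤ P.lag (U k) (V k) (lam k) :=
  (hA.min_second k (V k)).trans (hA.min_first k (U k))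

lemma lagGrad_first (hA : P.IsADMM U V lam) (k : ℕ) : P.lagGrad (V k) (U (k + 1)) (lam k) = 0 :=
  P.lagGrad_eq_zero fun U' => by
    rw [P.lag_symm, P.lag_symm _ U']; exact hA.min_first k U'

lemma lagGrad_second (hA : P.IsADMM U V lam) (k : ℕ) :
    P.lagGrad (U (k + 1)) (V (k + 1)) (lam k) = 0 :=
  P.lagGrad_eq_zero (hA.min_second k)

lemma isStep (hA : P.IsADMM U V lam) (k : ℕ) : P.IsStep (U (k + 1)) (V (k + 1)) (lam (k + 1))
    (U (k + 2)) (V (k + 2)) (lam (k + 2)) where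
  stat := by rw [hA.upd]; exact P.C_mult_of_lagGrad (hA.lagGrad_second k)
  first := hA.lagGrad_first (k + 1)
  second := hA.lagGrad_second (k + 1)
  upd := hA.upd (k + 1)

lemma lag_one_le (hA : P.IsADMM U V lam) : P.lag (U 1) (V 1) (lam 1 - P.ρ • P.res (U 1) (V 1))
    + ‖lam 1 - P.ρ • P.res (U 1) (V 1)‖ ^ 2 / P.ρ ≤ P.β₀ := by
  have h1 := hA.upd 0
  simp only [zero_add] at h1
  rw [h1, add_sub_cancel_right]
  linarith [hA.first_le 0, hA.init]

lemma good (hA : P.IsADMM U V lam)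
    [FiniteDimensional ℝ E] [FiniteDimensional ℝ M] [Nontrivial M] (k : ℕ) :
    P.Good (U (k + 2)) (V (k + 2)) (P.res (U (k + 2)) (V (k + 2))) ∧
      P.lag (U (k + 2)) (V (k + 2)) (lam (k + 2)) < P.β := by
  induction k with
  | zero => exact (hA.isStep 0).good_of_init hA.lag_one_le
  | succ k ih =>
    have hββ : P.β₀ ≤ P.β :=
      le_of_mul_le_mul_left (by nlinarith [P.mult_sq_lt, sq_nonneg P.mult]) P.ρ_pos
    have h12 := P.twelve_mul_le (((P.pen_le_lag (U 1) (V 1) _).trans hA.lag_one_le).trans hββ)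
    have hs := hA.isStep (k + 1)
    have hg := hs.good h12 ih.1 ih.2
    refine ⟨hg, lt_of_le_of_lt ?_ ih.2⟩
    have h1 := hs.descent ih.1 hg
    have h2 := (descent_pos (P := P)).le
    have h3 : 0 ≤ ‖U (k + 1 + 2) - U (k + 1 + 1)‖ ^ 2 + ‖V (k + 1 + 2) - V (k + 1 + 1)‖ ^ 2 := by
      positivity
    nlinarith [mul_nonneg h2 h3]

/-- Linear convergence of the iterates to a critical point. -/
theorem exists_linear_rate (hA : P.IsADMM U V lam)
    [FiniteDimensional ℝ E] [FiniteDimensional ℝ M] [Nontrivial M]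
    {α c δc : ℝ} (hα0 : 0 < α) (hα1 : α ≤ 1 / 2) (hδc : 0 < δc)
    (hLoj : ∀ p q : E × E × M, P.gradNorm q = 0 → dist p q ≤ δc →
      |P.lag p.1 p.2.1 p.2.2 - P.lag q.1 q.2.1 q.2.2| ^ α ≤ c * P.gradNorm p) :
    ∃ (k₀ : ℕ) (q : E × E × M) (ξ μ : ℝ), P.gradNorm q = 0 ∧ 0 < ξ ∧ 0 ≤ μ ∧ μ < 1 ∧
      ∀ k, dist (U (k₀ + k), V (k₀ + k), lam (k₀ + k)) q ≤ ξ * μ ^ k := by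
  have hpE : ProperSpace E := FiniteDimensional.proper ℝ E
  have hpM : ProperSpace M := FiniteDimensional.proper ℝ M
  have hδ := P.δ_pos
  set R := max (2 * P.δ) P.mult with hR
  have hRδ : 2 * P.δ ≤ R := le_max_left _ _
  have hR0 : 0 ≤ R := by linarith
  have hU : ∀ k, ‖U (k + 2)‖ ≤ R := fun k => by
    linarith [(hA.good k).1.add_le, norm_nonneg (V (k + 2))]
  have hV : ∀ k, ‖V (k + 2)‖ ≤ R := fun k => by
    linarith [(hA.good k).1.add_le, norm_nonneg (U (k + 2))]
  have hl : ∀ k, ‖lam (k + 2)‖ ≤ R := fun k =>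
    ((hA.good k).1.norm_mult_le P (hA.isStep (k + 1)).stat).trans (le_max_right _ _)
  obtain ⟨c₀, hc₀, hgrad⟩ := P.exists_gradNorm_le R hR0
  set z : ℕ → E × E × M := fun k => (U (k + 2), V (k + 2), lam (k + 2)) with hz
  set w : ℕ → ℝ := fun k => ‖U (k + 3) - U (k + 2)‖ ^ 2 + ‖V (k + 3) - V (k + 2)‖ ^ 2 with hw
  have hργ : 0 ≤ P.ρ * P.γ / 2 := by
    have := P.ρ_pos
    have := P.γ_pos
    positivity
  have hlam : ∀ k, ‖lam (k + 3) - lam (k + 2)‖ ^ 2 ≤ P.ρ * P.γ / 2 * w k := fun k =>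
    (hA.good k).1.sq_norm_mult_sub_le' P (hA.good (k + 1)).1 (hA.isStep (k + 1)).stat
      (hA.isStep (k + 2)).stat
  have hbdd : Bornology.IsBounded (Set.range z) := by
    refine isBounded_iff_forall_norm_le.2 ⟨R, ?_⟩
    rintro _ ⟨k, rfl⟩
    exact norm_prod_le_iff.2 ⟨hU k, norm_prod_le_iff.2 ⟨hV k, hl k⟩⟩
  have hdesc : ∀ k, P.lag (z (k + 1)).1 (z (k + 1)).2.1 (z (k + 1)).2.2 +
      (P.γ / 2 - 2 * P.lipU ^ 2 / (P.η ^ 2 * P.ρ)) * w k ≤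
      P.lag (z k).1 (z k).2.1 (z k).2.2 := by
    intro k
    exact (hA.isStep (k + 1)).descent (hA.good k).1 (hA.good (k + 1)).1
  have hdist : ∀ k, dist (z k) (z (k + 1)) ^ 2 ≤ (1 + P.ρ * P.γ / 2) * w k := by
    intro k
    have h1 : ‖U (k + 3) - U (k + 2)‖ ^ 2 ≤ w k := le_add_of_nonneg_right (sq_nonneg _)
    have h2 : ‖V (k + 3) - V (k + 2)‖ ^ 2 ≤ w k := le_add_of_nonneg_left (sq_nonneg _)
    have hw0 : 0 ≤ w k := (sq_nonneg _).trans h1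
    have hc1 : w k ≤ (1 + P.ρ * P.γ / 2) * w k := by nlinarith [mul_nonneg hργ hw0]
    have hb : 0 ≤ (1 + P.ρ * P.γ / 2) * w k := hw0.trans hc1
    rw [dist_comm, dist_eq_norm, ← Real.le_sqrt (norm_nonneg _) hb]
    refine norm_prod_le_iff.2 ⟨Real.le_sqrt_of_sq_le (h1.trans hc1),
      norm_prod_le_iff.2 ⟨Real.le_sqrt_of_sq_le (h2.trans hc1), Real.le_sqrt_of_sq_le ?_⟩⟩
    exact (hlam k).trans (by linarith)
  have hgr : ∀ k, P.gradNorm (z (k + 1)) ^ 2 ≤ c₀ * (1 + P.ρ * P.γ / 2) * w k := by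
    intro k
    refine (hgrad _ _ _ _ _ _ (hA.isStep (k + 1)) (hV k) (hU (k + 1)) (hV (k + 1)) (hl k)
      (hl (k + 1))).trans ?_
    rw [mul_assoc]
    refine mul_le_mul_of_nonneg_left ?_ hc₀
    have h1 : ‖V (k + 3) - V (k + 2)‖ ^ 2 ≤ w k := le_add_of_nonneg_left (sq_nonneg _)
    have h2 := hlam k
    show ‖V (k + 3) - V (k + 2)‖ ^ 2 + ‖lam (k + 3) - lam (k + 2)‖ ^ 2 ≤ _
    linarith
  obtain ⟨K, q, ξ, μ, hq, hξ, hμ0, hμ1, hrate⟩ := FactoredModel.exists_linear_rate_of_descent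
    (X := E × E × M) (z := z) (w := w) (κ := P.γ / 2 - 2 * P.lipU ^ 2 / (P.η ^ 2 * P.ρ))
    (c₁ := 1 + P.ρ * P.γ / 2) (c₂ := c₀ * (1 + P.ρ * P.γ / 2))
    P.continuous_lag P.continuous_gradNorm descent_pos (by positivity) (by positivity) hδc
    hα0 hα1 (fun k => by positivity) hbdd hdesc hdist hgr hLoj
  refine ⟨K + 2, q, ξ, μ, hq, hξ, hμ0, hμ1, fun k => ?_⟩
  have := hrate k
  simp only [hz] at this
  rwa [add_right_comm] at this

end IsADMM

end FactoredModel

open scoped Matrix.Norms.Frobenius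

section Frobenius

variable {α β κ : Type*} [Fintype α] [Fintype β] [Fintype κ]

lemma frobNorm_eq_norm (X : Matrix α β ℝ) : frobNorm X = ‖X‖ := by
  rw [Matrix.frobenius_norm_def, frobNorm, Real.sqrt_eq_rpow]
  simp

lemma vecNorm_eq_norm (v : α → ℝ) : vecNorm v = ‖WithLp.toLp 2 v‖ := by
  simp [vecNorm, EuclideanSpace.norm_eq]

/-- Matrices with the Frobenius inner product. -/
@[reducible] def frobInnerProductSpace : InnerProductSpace ℝ (Matrix α β ℝ) where
  inner := frobInner
  norm_sq_eq_re_inner X := by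
    rw [← frobNorm_eq_norm, frobNorm, Real.sq_sqrt (by positivity)]
    simp [frobInner, sq]
  conj_inner_symm X Y := by simp [frobInner, mul_comm]
  add_left X Y Z := by simp [frobInner, add_mul, Finset.sum_add_distrib]
  smul_left X Y c := by simp [frobInner, mul_assoc, Finset.mul_sum]

attribute [local instance] frobInnerProductSpace

lemma frobInner_eq_inner (X Y : Matrix α β ℝ) : frobInner X Y = ⟪X, Y⟫ := rfl

lemma frobInner_eq_trace (X Y : Matrix α β ℝ) : frobInner X Y = (Xᵀ * Y).trace := by
  simp only [frobInner, Matrix.trace, Matrix.diag, Matrix.mul_apply, Matrix.transpose_apply]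
  exact Finset.sum_comm

lemma frobInner_transpose (X Y : Matrix α β ℝ) : frobInner Xᵀ Yᵀ = frobInner X Y :=
  Finset.sum_comm

lemma frobInner_mul_left (X : Matrix α β ℝ) (Y : Matrix β κ ℝ) (Z : Matrix α κ ℝ) :
    frobInner (X * Y) Z = frobInner X (Z * Yᵀ) := by
  rw [frobInner_eq_trace, frobInner_eq_trace, Matrix.transpose_mul, Matrix.mul_assoc,
    Matrix.trace_mul_comm, Matrix.mul_assoc]

section Gradient

variable {n : ℕ} {f : Matrix (Fin n) (Fin n) ℝ → ℝ}
  {grad : Matrix (Fin n) (Fin n) ℝ → Matrix (Fin n) (Fin n) ℝ}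

lemma add_frobInner_grad_le (hconv : ConvexOn ℝ Set.univ f)
    (hgrad : ∀ X H, HasDerivAt (fun t : ℝ => f (X + t • H)) (frobInner (grad X) H) 0)
    (X Y : Matrix (Fin n) (Fin n) ℝ) : f X + frobInner (grad X) (Y - X) ≤ f Y := by
  have hline : ConvexOn ℝ Set.univ fun t : ℝ => f (X + t • (Y - X)) := by
    have := hconv.comp_affineMap (AffineMap.lineMap X Y : ℝ →ᵃ[ℝ] _)
    refine ConvexOn.congr this fun t _ => ?_
    simp [AffineMap.lineMap_apply, add_comm]
  have := hline.le_slope_of_hasDerivAt (Set.mem_univ 0) (Set.mem_univ 1) one_pos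
    (hgrad X (Y - X))
  simp [slope_def_field] at this
  linarith

lemma norm_grad_mul_sub_le {r : ℕ} {K g : ℝ} {U V U' V' : Matrix (Fin n) (Fin r) ℝ}
    (hK : 0 ≤ K) (hg : ‖grad (V * Uᵀ)‖ ≤ g)
    (hlip : ‖grad (V' * U'ᵀ) - grad (V * Uᵀ)‖ ≤ K * ‖V' * U'ᵀ - V * Uᵀ‖) :
    ‖grad (V' * U'ᵀ) * U' - grad (V * Uᵀ) * U‖ ≤
      K * (‖V'‖ * ‖U' - U‖ + ‖V' - V‖ * ‖U‖) * ‖U'‖ + g * ‖U' - U‖ := by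
  have h1 : grad (V' * U'ᵀ) * U' - grad (V * Uᵀ) * U =
      (grad (V' * U'ᵀ) - grad (V * Uᵀ)) * U' + grad (V * Uᵀ) * (U' - U) := by
    rw [Matrix.sub_mul, Matrix.mul_sub]; abel
  have h2 : V' * U'ᵀ - V * Uᵀ = V' * (U' - U)ᵀ + (V' - V) * Uᵀ := by
    rw [Matrix.sub_mul, Matrix.transpose_sub, Matrix.mul_sub]; abel
  have h3 : ‖V' * U'ᵀ - V * Uᵀ‖ ≤ ‖V'‖ * ‖U' - U‖ + ‖V' - V‖ * ‖U‖ := by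
    rw [h2]
    refine (norm_add_le _ _).trans (add_le_add ?_ ?_)
    · exact (Matrix.frobenius_norm_mul _ _).trans_eq (by rw [Matrix.frobenius_norm_transpose])
    · exact (Matrix.frobenius_norm_mul _ _).trans_eq (by rw [Matrix.frobenius_norm_transpose])
  rw [h1]
  refine (norm_add_le _ _).trans (add_le_add ?_ ?_)
  · refine (Matrix.frobenius_norm_mul _ _).trans ?_
    gcongr
    exact hlip.trans (by gcongr)
  · exact (Matrix.frobenius_norm_mul _ _).trans (by gcongr)

lemma norm_mul_transpose_le {r : ℕ} (U V : Matrix (Fin n) (Fin r) ℝ) :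
    ‖V * Uᵀ‖ ≤ ‖U‖ * ‖V‖ := by
  rw [mul_comm, ← Matrix.frobenius_norm_transpose U]
  exact Matrix.frobenius_norm_mul _ _

lemma exists_norm_grad_mul_sub_le {r : ℕ} (hcont : Continuous grad)
    (hlip : ∀ s : Set (Matrix (Fin n) (Fin n) ℝ), IsCompact s → Convex ℝ s →
      ∃ K : ℝ, ∀ X ∈ s, ∀ Y ∈ s, frobNorm (grad X - grad Y) ≤ K * frobNorm (X - Y)) (R : ℝ) :
    ∃ K, 0 ≤ K ∧ ∀ U U' V : Matrix (Fin n) (Fin r) ℝ, ‖U‖ ≤ R → ‖U'‖ ≤ R → ‖V‖ ≤ R →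
      ‖grad (V * U'ᵀ) * U' - grad (V * Uᵀ) * U‖ ≤ K * ‖U' - U‖ := by
  have hball : IsCompact (Metric.closedBall (0 : Matrix (Fin n) (Fin n) ℝ) (R * R)) :=
    have := FiniteDimensional.proper ℝ (Matrix (Fin n) (Fin n) ℝ)
    isCompact_closedBall _ _
  obtain ⟨K, hK⟩ := hlip _ hball (convex_closedBall _ _)
  obtain ⟨g, hg⟩ := hball.exists_bound_of_continuousOn hcont.continuousOn
  refine ⟨|K| * R ^ 2 + |g|, by positivity, fun U U' V hU hU' hV => ?_⟩
  have hR : 0 ≤ R := (norm_nonneg _).trans hU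
  have hmem : ∀ W : Matrix (Fin n) (Fin r) ℝ, ‖W‖ ≤ R →
      V * Wᵀ ∈ Metric.closedBall (0 : Matrix (Fin n) (Fin n) ℝ) (R * R) := fun W hW => by
    rw [mem_closedBall_zero_iff]
    exact (norm_mul_transpose_le W V).trans (by gcongr)
  have h1 := hK _ (hmem U' hU') _ (hmem U hU)
  rw [frobNorm_eq_norm, frobNorm_eq_norm] at h1
  have h2 := norm_grad_mul_sub_le (abs_nonneg K) ((hg _ (hmem U hU)).trans (le_abs_self g))
    (h1.trans (by gcongr; exact le_abs_self K))
  refine h2.trans ?_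
  rw [sub_self, norm_zero, zero_mul, add_zero, add_mul]
  refine add_le_add_left ?_ _
  calc |K| * (‖V‖ * ‖U' - U‖) * ‖U'‖ ≤ |K| * (R * ‖U' - U‖) * R := by gcongr
    _ = |K| * R ^ 2 * ‖U' - U‖ := by ring

end Gradient

section Constraint

variable {n m r : ℕ} (A : Fin m → Matrix (Fin n) (Fin n) ℝ)

/-- The bilinear map `(U, V) ↦ 𝒜 (U Vᵀ)`. -/
def constraintMap : Matrix (Fin n) (Fin r) ℝ →L[ℝ] Matrix (Fin n) (Fin r) ℝ →L[ℝ]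
    EuclideanSpace ℝ (Fin m) :=
  (LinearMap.mk₂ ℝ (fun U V : Matrix (Fin n) (Fin r) ℝ => WithLp.toLp 2 (Aop A (U * Vᵀ)))
    (fun U U' V => by
      ext i; simp [Aop, frobInner_eq_inner, Matrix.add_mul, inner_add_right])
    (fun c U V => by
      ext i; simp [Aop, frobInner_eq_inner, inner_smul_right])
    (fun U V V' => by
      ext i; simp [Aop, frobInner_eq_inner, Matrix.mul_add, inner_add_right])
    (fun c U V => by
      ext i; simp [Aop, frobInner_eq_inner, inner_smul_right])).toContinuousBilinearMap

/-- The bilinear map `(U, x) ↦ ∑ i, x i • (A i * U)`. -/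
def constraintAdjoint : Matrix (Fin n) (Fin r) ℝ →L[ℝ] EuclideanSpace ℝ (Fin m) →L[ℝ]
    Matrix (Fin n) (Fin r) ℝ :=
  (LinearMap.mk₂ ℝ (fun (U : Matrix (Fin n) (Fin r) ℝ) (x : EuclideanSpace ℝ (Fin m)) =>
      ∑ i, x i • (A i * U))
    (fun U U' x => by simp [Matrix.mul_add, Finset.sum_add_distrib])
    (fun c U x => by simp [Finset.smul_sum, smul_comm c])
    (fun U x y => by simp [add_smul, Finset.sum_add_distrib])
    (fun c U x => by simp [Finset.smul_sum, mul_smul])).toContinuousBilinearMap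

variable {A}

lemma constraintMap_symm (hA : ∀ i, (A i)ᵀ = A i) (U V : Matrix (Fin n) (Fin r) ℝ) :
    constraintMap A U V = constraintMap A V U := by
  ext i
  change frobInner (A i) (U * Vᵀ) = frobInner (A i) (V * Uᵀ)
  rw [← frobInner_transpose, hA]
  simp

lemma inner_constraintAdjoint (hA : ∀ i, (A i)ᵀ = A i) (U : Matrix (Fin n) (Fin r) ℝ)
    (x : EuclideanSpace ℝ (Fin m)) (V : Matrix (Fin n) (Fin r) ℝ) :
    ⟪constraintAdjoint A U x, V⟫ = ⟪x, constraintMap A U V⟫ := by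
  rw [constraintMap_symm hA]
  change ⟪∑ i, x i • (A i * U), V⟫ = ∑ i, frobInner (A i) (V * Uᵀ) * x i
  simp only [sum_inner, inner_smul_left, ← frobInner_eq_inner, frobInner_mul_left]
  simp [mul_comm]

lemma norm_constraintAdjoint_le (U : Matrix (Fin n) (Fin r) ℝ) (x : EuclideanSpace ℝ (Fin m)) :
    ‖constraintAdjoint A U x‖ ≤ √(sA A) * ‖U‖ * ‖x‖ := by
  change ‖∑ i, x i • (A i * U)‖ ≤ _
  calc ‖∑ i, x i • (A i * U)‖ ≤ ∑ i, ‖A i‖ * |x i| * ‖U‖ := by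
        refine (norm_sum_le _ _).trans (Finset.sum_le_sum fun i _ => ?_)
        rw [norm_smul, Real.norm_eq_abs, mul_comm ‖A i‖, mul_assoc]
        gcongr
        exact Matrix.frobenius_norm_mul _ _
    _ = (∑ i, ‖A i‖ * |x i|) * ‖U‖ := (Finset.sum_mul _ _ _).symm
    _ ≤ (√(∑ i, ‖A i‖ ^ 2) * √(∑ i, |x i| ^ 2)) * ‖U‖ := by
        gcongr
        exact Real.sum_mul_le_sqrt_mul_sqrt _ _ _
    _ = √(sA A) * ‖U‖ * ‖x‖ := by
        simp only [sA, frobNorm_eq_norm, EuclideanSpace.norm_eq, Real.norm_eq_abs]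
        ring

lemma vecNorm_Cmat_mulVec (U : Matrix (Fin n) (Fin r) ℝ) (x : EuclideanSpace ℝ (Fin m)) :
    vecNorm ((Cmat A U).mulVec x) = ‖constraintAdjoint A U x‖ := by
  rw [← frobNorm_eq_norm]
  change _ = frobNorm (∑ i, x i • (A i * U))
  rw [vecNorm, frobNorm, Fintype.sum_prod_type]
  simp [Cmat, Matrix.mulVec, dotProduct, Matrix.sum_apply, mul_comm]

lemma sigmaMin_Cmat_mul_norm_le (U : Matrix (Fin n) (Fin r) ℝ) (x : EuclideanSpace ℝ (Fin m)) :
    sigmaMin (Cmat A U) * ‖x‖ ≤ ‖constraintAdjoint A U x‖ := by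
  rcases eq_or_ne x 0 with rfl | hx
  · simp
  have hx' := norm_pos_iff.2 hx
  have h : sigmaMin (Cmat A U) ≤ ‖constraintAdjoint A U (‖x‖⁻¹ • x)‖ := by
    rw [← vecNorm_Cmat_mulVec]
    refine csInf_le ⟨0, ?_⟩ ⟨_, ?_, rfl⟩
    · rintro _ ⟨y, -, rfl⟩
      exact Real.sqrt_nonneg _
    · rw [vecNorm_eq_norm, WithLp.toLp_ofLp, norm_smul, norm_inv, norm_norm,
        inv_mul_cancel₀ hx'.ne']
  rwa [map_smul, norm_smul, norm_inv, norm_norm, inv_mul_eq_div, le_div_iff₀ hx'] at h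

end Constraint

section Instantiation

variable {n m r : ℕ} {f : Matrix (Fin n) (Fin n) ℝ → ℝ}
  {grad : Matrix (Fin n) (Fin n) ℝ → Matrix (Fin n) (Fin n) ℝ}
  {A : Fin m → Matrix (Fin n) (Fin n) ℝ} {b : Fin m → ℝ}

lemma vecNorm_constraint (U V : Matrix (Fin n) (Fin r) ℝ) :
    vecNorm (fun i => Aop A (U * Vᵀ) i - b i) = ‖constraintMap A U V - WithLp.toLp 2 b‖ :=
  vecNorm_eq_norm _

lemma gradAugLNorm_eq_zero_iff {ρ γ : ℝ}
    {q : Matrix (Fin n) (Fin r) ℝ × Matrix (Fin n) (Fin r) ℝ × (Fin m → ℝ)} :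
    gradAugLNorm grad A b ρ γ q.1 q.2.1 q.2.2 = 0 ↔ q ∈ KKTset r grad A b γ := by
  have h0 : vecNorm (fun i => Aop A (q.1 * q.2.1ᵀ) i - b i) = 0 →
      ∀ i, Aop A (q.1 * q.2.1ᵀ) i - b i = 0 := fun h i => by
    rw [vecNorm_eq_norm, norm_eq_zero] at h
    exact congrFun (congrArg WithLp.ofLp h) i
  have hnn : ∀ X : Matrix (Fin n) (Fin r) ℝ, frobNorm X ≤ 0 ↔ frobNorm X = 0 := fun X =>
    ⟨fun h => h.antisymm (Real.sqrt_nonneg _), le_of_eq⟩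
  have hvv : ∀ v : Fin m → ℝ, vecNorm v ≤ 0 ↔ vecNorm v = 0 := fun v =>
    ⟨fun h => h.antisymm (Real.sqrt_nonneg _), le_of_eq⟩
  rw [gradAugLNorm, Real.sqrt_eq_zero (by positivity),
    add_eq_zero_iff_of_nonneg (by positivity) (by positivity),
    add_eq_zero_iff_of_nonneg (by positivity) (by positivity)]
  simp only [KKTset, IsPenEpsKKT, Set.mem_ofPred_eq, hnn, hvv, sq_eq_zero_iff]
  constructor
  · rintro ⟨⟨h1, h2⟩, h3⟩
    simp only [h0 h3, mul_zero, add_zero] at h1 h2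
    exact ⟨h1, h2, h3⟩
  · rintro ⟨h1, h2, h3⟩
    refine ⟨⟨?_, ?_⟩, h3⟩ <;> simpa only [h0 h3, mul_zero, add_zero]

/-- The matrix problem satisfies the abstract assumptions. -/
lemma exists_factoredModel (hconv : ConvexOn ℝ Set.univ f) (hsym : ∀ X, f Xᵀ = f X)
    (hgrad : ∀ X H, HasDerivAt (fun t : ℝ => f (X + t • H)) (frobInner (grad X) H) 0)
    (hgradCont : Continuous grad)
    (hgradLipCompact : ∀ s : Set (Matrix (Fin n) (Fin n) ℝ), IsCompact s → Convex ℝ s →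
      ∃ K : ℝ, ∀ X ∈ s, ∀ Y ∈ s, frobNorm (grad X - grad Y) ≤ K * frobNorm (X - Y))
    (hAsym : ∀ i, (A i)ᵀ = A i) {ρ γ ρ₀ β0 βhat δ Lf L η : ℝ}
    (hρ : 0 < ρ) (hγ : 0 < γ) (hρ₀ : 0 < ρ₀) (hδ : 0 < δ) (hLf : 0 < Lf) (hL : 0 < L)
    (hη : 0 < η)
    (hδB : ∀ p ∈ Sset (r := r) f A b ρ₀ βhat, frobNorm p.1 ≤ δ ∧ frobNorm p.2 ≤ δ)
    (hgradB : ∀ X, frobNorm X ≤ δ ^ 2 → frobNorm (grad X) ≤ Lf)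
    (hgradLip : ∀ X Y, frobNorm X ≤ δ ^ 2 → frobNorm Y ≤ δ ^ 2 →
      frobNorm (grad X - grad Y) ≤ L * frobNorm (X - Y))
    (hηB : ∀ p ∈ Sset (r := r) f A b ρ₀ βhat, η ≤ sigmaMin (Cmat A p.1))
    (hρ₀γ : ρ₀ < γ) (hρ₀ρ : 2 * ρ₀ < ρ)
    (hbig : 4 * (L * δ ^ 2 + Lf + γ + (Lf * δ + 2 * γ * δ) / η * √(sA A)) ^ 2 < ρ * γ * η ^ 2)
    (hgap : ((Lf * δ + 2 * γ * δ) / η) ^ 2 < ρ * (βhat - β0)) :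
    ∃ P : FactoredModel (Matrix (Fin n) (Fin r) ℝ) (EuclideanSpace ℝ (Fin m)),
      P.ρ = ρ ∧ P.β₀ = β0 ∧
      (∀ U V, P.res U V = WithLp.toLp 2 fun i => Aop A (U * Vᵀ) i - b i) ∧
      (∀ U V lam, P.lag U V lam = augL f A b ρ γ U V lam) ∧
      ∀ p, P.gradNorm p = gradAugLNorm grad A b ρ γ p.1 p.2.1 p.2.2 := by
  simp only [frobNorm_eq_norm] at hδB hgradB hgradLip
  refine ⟨{
    h := fun U V => f (U * Vᵀ)
    G := fun U V => grad (V * Uᵀ) * U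
    B := constraintMap A
    C := constraintAdjoint A
    b := WithLp.toLp 2 b
    γ := γ
    ρ := ρ
    ρ₀ := ρ₀
    δ := δ
    η := η
    Lf := Lf
    L := L
    a := √(sA A)
    β₀ := β0
    β := βhat
    h_symm := fun U V => by rw [← hsym]; simp
    h_scale := fun s hs U V => by simp [smul_smul, hs]
    h_convex := fun U V V' => by
      have h := add_frobInner_grad_le hconv hgrad (V * Uᵀ) (V' * Uᵀ)
      rw [← Matrix.sub_mul, ← frobInner_mul_left, ← hsym (V * Uᵀ), ← hsym (V' * Uᵀ)] at h
      simp only [Matrix.transpose_mul, Matrix.transpose_transpose] at h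
      exact h
    h_cont := by
      have := hconv.continuousOn isOpen_univ
      rw [← continuousOn_univ.symm] at this
      fun_prop
    G_cont := by fun_prop
    B_symm := constraintMap_symm hAsym
    C_adjoint := inner_constraintAdjoint hAsym
    C_bound := norm_constraintAdjoint_le
    G_bound := fun U V h => (Matrix.frobenius_norm_mul _ _).trans <| by
      gcongr
      exact hgradB _ ((norm_mul_transpose_le U V).trans h)
    G_lip := fun U V U' V' h h' hU hU' => by
      have hm := (norm_mul_transpose_le U V).trans h
      have hm' := (norm_mul_transpose_le U' V').trans h'
      refine (norm_grad_mul_sub_le hL.le (hgradB _ hm) (hgradLip _ _ hm' hm)).trans ?_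
      have h1 : ‖U‖ * ‖U'‖ ≤ δ ^ 2 := by rw [sq]; gcongr
      have h2 := mul_le_mul_of_nonneg_left h' (mul_nonneg hL.le (norm_nonneg (U' - U)))
      have h3 := mul_le_mul_of_nonneg_left h1 (mul_nonneg hL.le (norm_nonneg (V' - V)))
      linarith
    G_lip_bdd := exists_norm_grad_mul_sub_le hgradCont hgradLipCompact
    γ_pos := hγ
    ρ_pos := hρ
    ρ₀_pos := hρ₀
    δ_pos := hδ
    η_pos := hη
    Lf_pos := hLf
    L_pos := hL
    a_nonneg := Real.sqrt_nonneg _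
    ρ₀_lt := hρ₀γ
    two_ρ₀_lt := hρ₀ρ
    level := fun U V h => by
      have hmem : (U, V) ∈ Sset (r := r) f A b ρ₀ βhat := by
        rw [Sset, Set.mem_ofPred_eq, frobNorm_eq_norm, vecNorm_constraint]
        exact h
      refine ⟨(hδB _ hmem).1, (hδB _ hmem).2, fun x => ?_⟩
      exact (mul_le_mul_of_nonneg_right (hηB _ hmem) (norm_nonneg x)).trans
        (sigmaMin_Cmat_mul_norm_le U x)
    ρ_big := hbig
    ρ_gap := hgap }, rfl, rfl, fun U V => rfl, fun U V lam => ?_, fun p => ?_⟩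
  · rw [augL, frobNorm_eq_norm, vecNorm_constraint]
    change _ + ⟪lam, constraintMap A U V - WithLp.toLp 2 b⟫ + _ = _
    rw [real_inner_comm]
    rfl
  · rw [gradAugLNorm, vecNorm_constraint]
    simp only [frobNorm_eq_norm]
    unfold FactoredModel.gradNorm FactoredModel.lagGrad
    rw [FactoredModel.res_symm _ p.2.1 p.1]
    rfl

lemma tripDist_le (p q : Matrix (Fin n) (Fin r) ℝ × Matrix (Fin n) (Fin r) ℝ ×
    EuclideanSpace ℝ (Fin m)) :
    tripDist (p.1, p.2.1, WithLp.ofLp p.2.2) (q.1, q.2.1, WithLp.ofLp q.2.2) ≤ 2 * dist p q := by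
  have h1 : ‖p.1 - q.1‖ ≤ dist p q := by
    rw [← dist_eq_norm]; exact le_max_left _ _
  have h2 : ‖p.2.1 - q.2.1‖ ≤ dist p q := by
    rw [← dist_eq_norm]; exact (le_max_left _ _).trans (le_max_right _ _)
  have h3 : ‖p.2.2 - q.2.2‖ ≤ dist p q := by
    rw [← dist_eq_norm]; exact (le_max_right _ _).trans (le_max_right _ _)
  have h1' := pow_le_pow_left₀ (norm_nonneg _) h1 2
  have h2' := pow_le_pow_left₀ (norm_nonneg _) h2 2
  have h3' := pow_le_pow_left₀ (norm_nonneg _) h3 2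
  refine Real.sqrt_le_iff.2 ⟨by positivity, ?_⟩
  rw [frobNorm_eq_norm, frobNorm_eq_norm, vecNorm_eq_norm]
  change _ + _ + ‖p.2.2 - q.2.2‖ ^ 2 ≤ _
  nlinarith [sq_nonneg (dist p q)]

/-- Linear convergence of the ADMM iterates, for a model of the matrix problem. -/
lemma FactoredModel.exists_infDist_KKTset_le
    (P : FactoredModel (Matrix (Fin n) (Fin r) ℝ) (EuclideanSpace ℝ (Fin m))) {ρ γ β0 : ℝ}
    (hm : 0 < m) (hPρ : P.ρ = ρ) (hPβ : P.β₀ = β0)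
    (hres : ∀ U V, P.res U V = WithLp.toLp 2 fun i => Aop A (U * Vᵀ) i - b i)
    (hlag : ∀ U V lam, P.lag U V lam = augL f A b ρ γ U V lam)
    (hnorm : ∀ p, P.gradNorm p = gradAugLNorm grad A b ρ γ p.1 p.2.1 p.2.2)
    {U V : ℕ → Matrix (Fin n) (Fin r) ℝ} {lam : ℕ → Fin m → ℝ}
    (hUmin : ∀ k U', augL f A b ρ γ (U (k + 1)) (V k) (lam k) ≤ augL f A b ρ γ U' (V k) (lam k))
    (hVmin : ∀ k V', augL f A b ρ γ (U (k + 1)) (V (k + 1)) (lam k) ≤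
      augL f A b ρ γ (U (k + 1)) V' (lam k))
    (hupd : ∀ k, lam (k + 1) = fun i => lam k i + ρ * (Aop A (U (k + 1) * (V (k + 1))ᵀ) i - b i))
    (hinit : augL f A b ρ γ (U 0) (V 0) (lam 0) + 1 / ρ * (vecNorm (lam 0)) ^ 2 ≤ β0)
    {α : ℝ} (hα0 : 0 < α) (hα1 : α ≤ 1 / 2)
    (hLoj : ∃ c δc : ℝ, 0 < c ∧ 0 < δc ∧
      ∀ p q : Matrix (Fin n) (Fin r) ℝ × Matrix (Fin n) (Fin r) ℝ × (Fin m → ℝ),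
        q ∈ KKTset r grad A b γ → tripDist p q ≤ δc →
        |augL f A b ρ γ p.1 p.2.1 p.2.2 - augL f A b ρ γ q.1 q.2.1 q.2.2| ^ α
          ≤ c * gradAugLNorm grad A b ρ γ p.1 p.2.1 p.2.2) :
    ∃ (k₀ : ℕ) (ξ μ : ℝ), 0 < ξ ∧ 0 ≤ μ ∧ μ < 1 ∧ ∀ k : ℕ, k₀ < k →
      sInf (tripDist (U k, V k, lam k) '' KKTset r grad A b γ) ≤ ξ * μ ^ (k - k₀) := by
  have : Nonempty (Fin m) := ⟨⟨0, hm⟩⟩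
  have hA : P.IsADMM U V fun k => WithLp.toLp 2 (lam k) :=
    { min_first := fun k U' => by simpa only [hlag] using hUmin k U'
      min_second := fun k V' => by simpa only [hlag] using hVmin k V'
      upd := fun k => by rw [hupd, hres, hPρ]; rfl
      init := by
        rw [hlag, hPρ, hPβ, ← vecNorm_eq_norm, ← one_div_mul_eq_div]
        exact hinit }
  have hKKT : ∀ q, P.gradNorm q = 0 →
      (q.1, q.2.1, WithLp.ofLp q.2.2) ∈ KKTset r grad A b γ := fun q hq =>
    (gradAugLNorm_eq_zero_iff (ρ := ρ)).1 ((hnorm q).symm.trans hq)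
  obtain ⟨c, δc, -, hδc, hLoj⟩ := hLoj
  obtain ⟨k₀, q, ξ, μ, hq, hξ, hμ0, hμ1, hrate⟩ := hA.exists_linear_rate (c := c) hα0 hα1
    (half_pos hδc) fun p q hq hpq => by
      rw [hlag, hlag, hnorm]
      exact hLoj (p.1, p.2.1, WithLp.ofLp p.2.2) (q.1, q.2.1, WithLp.ofLp q.2.2) (hKKT q hq)
        ((tripDist_le p q).trans (by linarith))
  refine ⟨k₀, 2 * ξ, μ, by positivity, hμ0, hμ1, fun k hk => ?_⟩
  have hbdd : BddBelow (tripDist (U k, V k, lam k) '' KKTset r grad A b γ) := by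
    refine ⟨0, ?_⟩
    rintro _ ⟨x, -, rfl⟩
    exact Real.sqrt_nonneg _
  have hk' := hrate (k - k₀)
  rw [Nat.add_sub_cancel' hk.le] at hk'
  have h := tripDist_le (U k, V k, WithLp.toLp 2 (lam k)) q
  exact (csInf_le hbdd ⟨_, hKKT q hq, rfl⟩).trans (h.trans (by linarith))

end Instantiation

end Frobenius

end Convergence

/-- Theorem 3.2(ii): linear convergence of the distance to the KKT set when
the Łojasiewicz inequality holds with exponent α ∈ (0, 1/2]. -/
theorem admm_linear_convergence
    (n m r : ℕ) (hn : 0 < n) (hm : 0 < m) (hr : 0 < r)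
    (f : Matrix (Fin n) (Fin n) ℝ → ℝ)
    (hconv : ConvexOn ℝ Set.univ f)
    (hsym : ∀ X : Matrix (Fin n) (Fin n) ℝ, f Xᵀ = f X)
    (grad : Matrix (Fin n) (Fin n) ℝ → Matrix (Fin n) (Fin n) ℝ)
    (hgrad : ∀ X H : Matrix (Fin n) (Fin n) ℝ,
      HasDerivAt (fun t : ℝ => f (X + t • H)) (frobInner (grad X) H) 0)
    (hgradCont : Continuous grad)
    (hess : Matrix (Fin n) (Fin n) ℝ → Matrix (Fin n) (Fin n) ℝ → Matrix (Fin n) (Fin n) ℝ)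
    (hhess : ∀ X H : Matrix (Fin n) (Fin n) ℝ, ∀ i j,
      HasDerivAt (fun t : ℝ => grad (X + t • H) i j) (hess X H i j) 0)
    (hgradLipCompact : ∀ s : Set (Matrix (Fin n) (Fin n) ℝ), IsCompact s → Convex ℝ s →
      ∃ K : ℝ, ∀ X ∈ s, ∀ Y ∈ s, frobNorm (grad X - grad Y) ≤ K * frobNorm (X - Y))
    (hhessLipCompact : ∀ s : Set (Matrix (Fin n) (Fin n) ℝ), IsCompact s → Convex ℝ s →
      ∃ K : ℝ, ∀ X ∈ s, ∀ Y ∈ s, ∀ H : Matrix (Fin n) (Fin n) ℝ,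
        frobNorm (hess X H - hess Y H) ≤ K * frobNorm H * frobNorm (X - Y))
    (A : Fin m → Matrix (Fin n) (Fin n) ℝ) (hAsym : ∀ i, (A i)ᵀ = A i)
    (b : Fin m → ℝ)
    (hfeas : ∃ Uf Vf : Matrix (Fin n) (Fin r) ℝ, ∀ i, Aop A (Uf * Vfᵀ) i = b i)
    (hWne : (KKTset r grad A b γ).Nonempty)
    (ρ γ ρ₀ : ℝ) (hρpos : 0 < ρ) (hγpos : 0 < γ) (hρ₀pos : 0 < ρ₀)
    (U V : ℕ → Matrix (Fin n) (Fin r) ℝ) (lam : ℕ → Fin m → ℝ)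
    (hUmin : ∀ k : ℕ, ∀ U' : Matrix (Fin n) (Fin r) ℝ,
      augL f A b ρ γ (U (k + 1)) (V k) (lam k) ≤ augL f A b ρ γ U' (V k) (lam k))
    (hVmin : ∀ k : ℕ, ∀ V' : Matrix (Fin n) (Fin r) ℝ,
      augL f A b ρ γ (U (k + 1)) (V (k + 1)) (lam k) ≤ augL f A b ρ γ (U (k + 1)) V' (lam k))
    (hlamUpd : ∀ k : ℕ,
      lam (k + 1) = fun i => lam k i + ρ * (Aop A (U (k + 1) * (V (k + 1))ᵀ) i - b i))
    (hlevel : ∀ β : ℝ, IsCompact (Sset (r := r) f A b ρ₀ β) ∨ Sset (r := r) f A b ρ₀ β = ∅)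
    (β0 βhat : ℝ) (hββ : β0 < βhat)
    (hinit : augL f A b ρ γ (U 0) (V 0) (lam 0) + 1 / ρ * (vecNorm (lam 0)) ^ 2 ≤ β0)
    (δ : ℝ) (hδpos : 0 < δ)
    (hδB : ∀ p ∈ Sset (r := r) f A b ρ₀ βhat, frobNorm p.1 ≤ δ ∧ frobNorm p.2 ≤ δ)
    (Lf L : ℝ) (hLfpos : 0 < Lf) (hLpos : 0 < L)
    (hgradB : ∀ X : Matrix (Fin n) (Fin n) ℝ, frobNorm X ≤ δ ^ 2 → frobNorm (grad X) ≤ Lf)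
    (hgradLip : ∀ X Y : Matrix (Fin n) (Fin n) ℝ, frobNorm X ≤ δ ^ 2 → frobNorm Y ≤ δ ^ 2 →
      frobNorm (grad X - grad Y) ≤ L * frobNorm (X - Y))
    (η : ℝ) (hηpos : 0 < η)
    (hηB : ∀ p ∈ Sset (r := r) f A b ρ₀ βhat, η ≤ sigmaMin (Cmat A p.1))
    (c₁ c₂ : ℝ)
    (hc₁ : c₁ = 2 / η ^ 2 * (L * δ ^ 2 + Lf + γ + 1 / η * Lf * δ * Real.sqrt (sA A)
      + 2 / η * γ * δ * Real.sqrt (sA A)) ^ 2)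
    (hc₂ : c₂ = 2 / η ^ 2 * (L * δ ^ 2 + γ) ^ 2)
    (hγρ₀ : ρ₀ < γ)
    (hρbig : max (max (2 * ρ₀) (2 * c₁ / γ))
      (max (2 * c₂ / γ) (((Lf * δ + 2 * γ * δ) / η) ^ 2 / (βhat - β0))) < ρ)
    (α : ℝ) (hα0 : 0 < α) (hα1 : α ≤ 1 / 2)
    (hLoj : ∃ c δc : ℝ, 0 < c ∧ 0 < δc ∧
      ∀ p q : Matrix (Fin n) (Fin r) ℝ × Matrix (Fin n) (Fin r) ℝ × (Fin m → ℝ),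
        q ∈ KKTset r grad A b γ → tripDist p q ≤ δc →
        |augL f A b ρ γ p.1 p.2.1 p.2.2 - augL f A b ρ γ q.1 q.2.1 q.2.2| ^ α
          ≤ c * gradAugLNorm grad A b ρ γ p.1 p.2.1 p.2.2)
    :
    ∃ (k₀ : ℕ) (ξ μ : ℝ), 0 < ξ ∧ 0 ≤ μ ∧ μ < 1 ∧ ∀ k : ℕ, k₀ < k →
      sInf (tripDist (U k, V k, lam k) '' KKTset r grad A b γ) ≤ ξ * μ ^ (k - k₀) := by
  simp only [max_lt_iff] at hρbig
  obtain ⟨⟨hρ₀ρ, hc₁ρ⟩, -, hgap⟩ := hρbig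
  rw [div_lt_iff₀ (by linarith)] at hgap
  have hbig : 4 * (L * δ ^ 2 + Lf + γ + (Lf * δ + 2 * γ * δ) / η * √(sA A)) ^ 2
      < ρ * γ * η ^ 2 := by
    rw [hc₁, div_lt_iff₀ hγpos] at hc₁ρ
    rw [← div_lt_iff₀ (by positivity)]
    refine lt_of_eq_of_lt ?_ hc₁ρ
    field_simp
    ring
  obtain ⟨P, hPρ, hPβ, hres, hlag, hnorm⟩ := exists_factoredModel hconv hsym hgrad hgradCont
    hgradLipCompact hAsym hρpos hγpos hρ₀pos hδpos hLfpos hLpos hηpos hδB hgradB hgradLip hηB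
    hγρ₀ hρ₀ρ hbig hgap
  exact P.exists_infDist_KKTset_le hm hPρ hPβ hres hlag hnorm hUmin hVmin hlamUpd hinit
    hα0 hα1 hLoj
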